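/- Let R be an N=1 (resp. N=2) SUSY Lie conformal algebra. Then the supersymmetric algebra S(R) = S(R_even) ⊗ Λ(R_odd) carries an N=1 (resp. N=2) SUSY PVA structure whose Λ-bracket is the unique extension of the bracket of R by the Leibniz rule, and whose odd derivation D (resp. odd derivations D and D̃) is the extension of that of R to a derivation on S(R). -/

import Mathlib

noncomputable section

/-- The sign `(-1)^{ij}` for parities `i, j : ZMod 2`. -/
def sg (i j : ZMod 2) : ℂ := (-1 : ℂ) ^ (i.val * j.val)

/-- The sign `(-1)^{i}` for a parity `i : ZMod 2`. -/
def sg1 (i : ZMod 2) : ℂ := (-1 : ℂ) ^ i.val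

/-- The data of a Poisson vertex algebra structure on a unital associative
`ℂ`-superalgebra `P`: a `ℤ/2`-grading `part`, an even derivation `∂ = der`,
and a `λ`-bracket `{a_λ b} = ∑_{n≥0} (λⁿ/n!) (lb a b n)` with a support bound
`bnd`. -/
structure PVAData (P : Type) [Ring P] [Algebra ℂ P] where
  part : ZMod 2 → Submodule ℂ P
  der : P →ₗ[ℂ] P
  lb : P →ₗ[ℂ] P →ₗ[ℂ] (ℕ → P)
  bnd : P → P → ℕ

namespace PVAData

variable {P : Type} [Ring P] [Algebra ℂ P] (d : PVAData P)

/-- The axioms of a Poisson vertex algebra (with its `ℤ/2`-grading):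
`P` is a unital supercommutative associative differential superalgebra, and
the `λ`-bracket (written in coefficients, `{a_λ b} = ∑ λⁿ/n! · lb a b n`)
satisfies sesquilinearity, skewsymmetry, the Jacobi identity and the Leibniz
rule. -/
structure IsPVA : Prop where
  compl : IsCompl (d.part 0) (d.part 1)
  one_mem : (1 : P) ∈ d.part 0
  mul_mem : ∀ (i j : ZMod 2), ∀ a ∈ d.part i, ∀ b ∈ d.part j,
    a * b ∈ d.part (i + j)
  scomm : ∀ (i j : ZMod 2), ∀ a ∈ d.part i, ∀ b ∈ d.part j,
    a * b = sg i j • (b * a)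
  der_mem : ∀ (i : ZMod 2), ∀ a ∈ d.part i, d.der a ∈ d.part i
  der_mul : ∀ a b : P, d.der (a * b) = d.der a * b + a * d.der b
  lb_mem : ∀ (i j : ZMod 2), ∀ a ∈ d.part i, ∀ b ∈ d.part j, ∀ n,
    d.lb a b n ∈ d.part (i + j)
  lb_bnd : ∀ a b n, d.bnd a b ≤ n → d.lb a b n = 0
  -- sesquilinearity: `{∂a_λ b} = -λ{a_λ b}`, `{a_λ ∂b} = (∂+λ){a_λ b}`
  sesq1₀ : ∀ a b : P, d.lb (d.der a) b 0 = 0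
  sesq1 : ∀ (a b : P) (n : ℕ),
    d.lb (d.der a) b (n + 1) = -((n + 1 : ℕ) : ℂ) • d.lb a b n
  sesq2₀ : ∀ a b : P, d.lb a (d.der b) 0 = d.der (d.lb a b 0)
  sesq2 : ∀ (a b : P) (n : ℕ), d.lb a (d.der b) (n + 1) =
    d.der (d.lb a b (n + 1)) + ((n + 1 : ℕ) : ℂ) • d.lb a b n
  -- skewsymmetry: `{a_λ b} = -(-1)^{p(a)p(b)} {b_{-λ-∂} a}`
  skew : ∀ (i j : ZMod 2), ∀ a ∈ d.part i, ∀ b ∈ d.part j, ∀ n,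
    d.lb a b n = -sg i j • ∑ k ∈ Finset.range (d.bnd b a + 1),
      (((-1 : ℂ) ^ (n + k)) / (Nat.factorial k : ℂ)) •
        (d.der ^ k) (d.lb b a (n + k))
  -- Jacobi identity:
  -- `{a_λ{b_γ c}} = {{a_λ b}_{λ+γ} c} + (-1)^{p(a)p(b)}{b_γ{a_λ c}}`
  jacobi : ∀ (i j : ZMod 2), ∀ a ∈ d.part i, ∀ b ∈ d.part j, ∀ (c : P)
    (m n : ℕ), d.lb a (d.lb b c n) m =
      (∑ k ∈ Finset.range (m + 1),
        ((Nat.choose m k : ℕ) : ℂ) • d.lb (d.lb a b k) c (m + n - k)) +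
      sg i j • d.lb b (d.lb a c m) n
  -- Leibniz rule: `{a_λ bc} = {a_λ b}c + (-1)^{p(a)p(b)} b{a_λ c}`
  leibniz : ∀ (i j : ZMod 2), ∀ a ∈ d.part i, ∀ b ∈ d.part j, ∀ (c : P) (n : ℕ),
    d.lb a (b * c) n = d.lb a b n * c + sg i j • (b * d.lb a c n)

/-- The conformal weight space `P_Δ` of quasi-primary vectors for a candidate
conformal vector `L`: elements `a` with
`{L_λ a} = (2∂ + 2Δλ)a + O(λ²)`. -/
def confWtSet (L : P) (Δ : ℝ) : Set P :=
  {a | d.lb L a 0 = (2 : ℂ) • d.der a ∧ d.lb L a 1 = ((2 * Δ : ℝ) : ℂ) • a}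

/-- `L` is a conformal vector of central charge `c`:
`{L_λ L} = (2∂ + 4λ)L + (λ³/3)c` and `P` is the (bounded-below) sum of its
conformal weight spaces. -/
def IsConformalVector (L : P) (c : ℂ) : Prop :=
  L ∈ d.part 0 ∧
  d.lb L L 0 = (2 : ℂ) • d.der L ∧
  d.lb L L 1 = (4 : ℂ) • L ∧
  d.lb L L 2 = 0 ∧
  d.lb L L 3 = (2 * c) • (1 : P) ∧
  (∀ n, 4 ≤ n → d.lb L L n = 0) ∧
  ∃ M : ℝ, (∀ Δ : ℝ, Δ < M → d.confWtSet L Δ ⊆ {0}) ∧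
    Submodule.span ℂ (⋃ Δ : ℝ, d.confWtSet L Δ) = ⊤

/-- `a` is primary of conformal weight `Δ` with respect to `L`:
`{L_λ a} = (2∂ + 2Δλ)a` exactly. -/
def IsPrimary (L a : P) (Δ : ℝ) : Prop :=
  d.lb L a 0 = (2 : ℂ) • d.der a ∧
  d.lb L a 1 = ((2 * Δ : ℝ) : ℂ) • a ∧
  ∀ n, 2 ≤ n → d.lb L a n = 0

end PVAData
/-- The data of an `N=1` SUSY Poisson vertex algebra structure on a unital
associative `ℂ`-superalgebra `P`: a `ℤ/2`-grading `part`, the even derivation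
`∂ = der` and odd derivation `D = sder`, and the `Λ`-bracket
`{a_Λ b} = ∑_{n≥0} (λⁿ/n!) (lb0 a b n + χ · lb1 a b n)`
(components `lb0 a b n = a_{(n|0)} b`, `lb1 a b n = a_{(n|1)} b`). -/
structure SPVAData (P : Type) [Ring P] [Algebra ℂ P] where
  part : ZMod 2 → Submodule ℂ P
  der : P →ₗ[ℂ] P
  sder : P →ₗ[ℂ] P
  lb0 : P →ₗ[ℂ] P →ₗ[ℂ] (ℕ → P)
  lb1 : P →ₗ[ℂ] P →ₗ[ℂ] (ℕ → P)
  bnd : P → P → ℕ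

namespace SPVAData

variable {P : Type} [Ring P] [Algebra ℂ P] (d : SPVAData P)

/-- The axioms of an `N=1` SUSY Poisson vertex algebra, in terms of the
coefficients of the `Λ`-bracket
`{a_Λ b} = ∑_m (λᵐ/m!)(a_{(m|0)}b + χ a_{(m|1)}b)`, `Λ = (λ,χ)`, χ² = -λ:
`P` is a unital supercommutative associative superalgebra with even derivation
`∂` and odd derivation `D`, `D² = ∂`, and the bracket is odd and satisfies
sesquilinearity (`{Da_Λ b} = χ{a_Λ b}`,
`{a_Λ Db} = (-1)^{p(a)+1}(D+χ){a_Λ b}`), skewsymmetry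
(`{a_Λ b} = (-1)^{p(a)p(b)}{b_{-Λ-∇} a}`), the `N=1` SUSY Jacobi identity and
the Leibniz rule. -/
structure IsSPVA : Prop where
  compl : IsCompl (d.part 0) (d.part 1)
  one_mem : (1 : P) ∈ d.part 0
  mul_mem : ∀ (i j : ZMod 2), ∀ a ∈ d.part i, ∀ b ∈ d.part j,
    a * b ∈ d.part (i + j)
  scomm : ∀ (i j : ZMod 2), ∀ a ∈ d.part i, ∀ b ∈ d.part j,
    a * b = sg i j • (b * a)
  der_mem : ∀ (i : ZMod 2), ∀ a ∈ d.part i, d.der a ∈ d.part i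
  der_mul : ∀ a b : P, d.der (a * b) = d.der a * b + a * d.der b
  sder_mem : ∀ (i : ZMod 2), ∀ a ∈ d.part i, d.sder a ∈ d.part (i + 1)
  sder_mul : ∀ (i : ZMod 2), ∀ a ∈ d.part i, ∀ b : P,
    d.sder (a * b) = d.sder a * b + sg1 i • (a * d.sder b)
  sder_sq : ∀ a : P, d.sder (d.sder a) = d.der a
  lb0_mem : ∀ (i j : ZMod 2), ∀ a ∈ d.part i, ∀ b ∈ d.part j, ∀ n,
    d.lb0 a b n ∈ d.part (i + j + 1)
  lb1_mem : ∀ (i j : ZMod 2), ∀ a ∈ d.part i, ∀ b ∈ d.part j, ∀ n,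
    d.lb1 a b n ∈ d.part (i + j)
  lb0_bnd : ∀ a b n, d.bnd a b ≤ n → d.lb0 a b n = 0
  lb1_bnd : ∀ a b n, d.bnd a b ≤ n → d.lb1 a b n = 0
  -- sesquilinearity in the first argument: `{Da_Λ b} = χ{a_Λ b}`
  sesq1₀ : ∀ a b : P, d.lb0 (d.sder a) b 0 = 0
  sesq1 : ∀ (a b : P) (n : ℕ),
    d.lb0 (d.sder a) b (n + 1) = -((n + 1 : ℕ) : ℂ) • d.lb1 a b n
  sesq1' : ∀ (a b : P) (n : ℕ), d.lb1 (d.sder a) b n = d.lb0 a b n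
  -- sesquilinearity in the second argument:
  -- `{a_Λ Db} = (-1)^{p(a)+1}(D+χ){a_Λ b}`
  sesq2₀ : ∀ (i : ZMod 2), ∀ a ∈ d.part i, ∀ b : P,
    d.lb0 a (d.sder b) 0 = sg1 (i + 1) • d.sder (d.lb0 a b 0)
  sesq2 : ∀ (i : ZMod 2), ∀ a ∈ d.part i, ∀ (b : P) (n : ℕ),
    d.lb0 a (d.sder b) (n + 1) = sg1 (i + 1) •
      (d.sder (d.lb0 a b (n + 1)) + ((n + 1 : ℕ) : ℂ) • d.lb1 a b n)
  sesq2' : ∀ (i : ZMod 2), ∀ a ∈ d.part i, ∀ (b : P) (n : ℕ),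
    d.lb1 a (d.sder b) n = sg1 (i + 1) •
      (d.lb0 a b n - d.sder (d.lb1 a b n))
  -- skewsymmetry: `{a_Λ b} = (-1)^{p(a)p(b)} {b_{-Λ-∇} a}`
  skew0 : ∀ (i j : ZMod 2), ∀ a ∈ d.part i, ∀ b ∈ d.part j, ∀ n,
    d.lb0 a b n = sg i j • ∑ k ∈ Finset.range (d.bnd b a + 1),
      (((-1 : ℂ) ^ (n + k)) / (Nat.factorial k : ℂ)) •
        (d.der ^ k) (d.lb0 b a (n + k) - d.sder (d.lb1 b a (n + k)))
  skew1 : ∀ (i j : ZMod 2), ∀ a ∈ d.part i, ∀ b ∈ d.part j, ∀ n,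
    d.lb1 a b n = -sg i j • ∑ k ∈ Finset.range (d.bnd b a + 1),
      (((-1 : ℂ) ^ (n + k)) / (Nat.factorial k : ℂ)) •
        (d.der ^ k) (d.lb1 b a (n + k))
  -- the `N=1` SUSY Jacobi identity
  -- `{a_Λ{b_Γ c}} = (-1)^{p(a)+1}{{a_Λ b}_{Γ+Λ} c}
  --                + (-1)^{(p(a)+1)(p(b)+1)}{b_Γ{a_Λ c}}`,
  -- written out in the components `1, χ, η, χη` of `C[λ,γ,χ,η] ⊗ P`
  jacobi00 : ∀ (i j : ZMod 2), ∀ a ∈ d.part i, ∀ b ∈ d.part j, ∀ (c : P)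
    (m n : ℕ), d.lb0 a (d.lb0 b c n) m = sg1 (i + 1) •
      ((∑ k ∈ Finset.range (m + 1),
        ((Nat.choose m k : ℕ) : ℂ) • d.lb0 (d.lb0 a b k) c (m + n - k)) +
       (∑ k ∈ Finset.range m,
        (((k + 1) * Nat.choose m (k + 1) : ℕ) : ℂ) •
          d.lb1 (d.lb1 a b k) c (m + n - k - 1))) +
      sg (i + 1) (j + 1) • d.lb0 b (d.lb0 a c m) n
  jacobi10 : ∀ (i j : ZMod 2), ∀ a ∈ d.part i, ∀ b ∈ d.part j, ∀ (c : P)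
    (m n : ℕ), d.lb1 a (d.lb0 b c n) m = sg1 (i + 1) •
      (∑ k ∈ Finset.range (m + 1), ((Nat.choose m k : ℕ) : ℂ) •
        (d.lb1 (d.lb0 a b k) c (m + n - k) - d.lb0 (d.lb1 a b k) c (m + n - k))) +
      (sg (i + 1) (j + 1) * sg1 (j + 1)) • d.lb0 b (d.lb1 a c m) n
  jacobi01 : ∀ (i j : ZMod 2), ∀ a ∈ d.part i, ∀ b ∈ d.part j, ∀ (c : P)
    (m n : ℕ), sg1 (i + 1) • d.lb0 a (d.lb1 b c n) m = sg1 (i + 1) •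
      (∑ k ∈ Finset.range (m + 1),
        ((Nat.choose m k : ℕ) : ℂ) • d.lb1 (d.lb0 a b k) c (m + n - k)) +
      sg (i + 1) (j + 1) • d.lb1 b (d.lb0 a c m) n
  jacobi11 : ∀ (i j : ZMod 2), ∀ a ∈ d.part i, ∀ b ∈ d.part j, ∀ (c : P)
    (m n : ℕ), sg1 i • d.lb1 a (d.lb1 b c n) m = sg1 i •
      (∑ k ∈ Finset.range (m + 1),
        ((Nat.choose m k : ℕ) : ℂ) • d.lb1 (d.lb1 a b k) c (m + n - k)) +
      (sg (i + 1) (j + 1) * sg1 (j + 1)) • d.lb1 b (d.lb1 a c m) n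
  -- the Leibniz rule `{a_Λ bc} = {a_Λ b}c + (-1)^{(p(a)+1)p(b)} b{a_Λ c}`
  leibniz0 : ∀ (i j : ZMod 2), ∀ a ∈ d.part i, ∀ b ∈ d.part j, ∀ (c : P) (n : ℕ),
    d.lb0 a (b * c) n = d.lb0 a b n * c + sg (i + 1) j • (b * d.lb0 a c n)
  leibniz1 : ∀ (i j : ZMod 2), ∀ a ∈ d.part i, ∀ b ∈ d.part j, ∀ (c : P) (n : ℕ),
    d.lb1 a (b * c) n = d.lb1 a b n * c + sg i j • (b * d.lb1 a c n)

/-- The conformal weight space of quasi-primary vectors for a candidate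
`N=1` superconformal vector `G`: elements `a` with
`{G_Λ a} = (2∂ + 2Δλ + χD)a + O(Λ²)`. -/
def sconfWtSet (G : P) (Δ : ℝ) : Set P :=
  {a | d.lb0 G a 0 = (2 : ℂ) • d.der a ∧
       d.lb0 G a 1 = ((2 * Δ : ℝ) : ℂ) • a ∧
       d.lb1 G a 0 = d.sder a}

/-- `G` is an `N=1` superconformal vector of central charge `c`:
`G` is odd, `{G_Λ G} = (2∂ + 3λ + χD)G + (λ²χ/3)c`, and `P` is the
(bounded-below) sum of the conformal weight spaces of `G`. -/
def IsSuperconformal (G : P) (c : ℂ) : Prop :=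
  G ∈ d.part 1 ∧
  d.lb0 G G 0 = (2 : ℂ) • d.der G ∧
  d.lb0 G G 1 = (3 : ℂ) • G ∧
  (∀ n, 2 ≤ n → d.lb0 G G n = 0) ∧
  d.lb1 G G 0 = d.sder G ∧
  d.lb1 G G 1 = 0 ∧
  d.lb1 G G 2 = (2 * c / 3) • (1 : P) ∧
  (∀ n, 3 ≤ n → d.lb1 G G n = 0) ∧
  ∃ M : ℝ, (∀ Δ : ℝ, Δ < M → d.sconfWtSet G Δ ⊆ {0}) ∧
    Submodule.span ℂ (⋃ Δ : ℝ, d.sconfWtSet G Δ) = ⊤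

/-- `a` is primary of conformal weight `Δ` with respect to the `N=1`
superconformal vector `G`: `{G_Λ a} = (2∂ + 2Δλ + χD)a` exactly. -/
def IsPrimary (G a : P) (Δ : ℝ) : Prop :=
  d.lb0 G a 0 = (2 : ℂ) • d.der a ∧
  d.lb0 G a 1 = ((2 * Δ : ℝ) : ℂ) • a ∧
  (∀ n, 2 ≤ n → d.lb0 G a n = 0) ∧
  d.lb1 G a 0 = d.sder a ∧
  (∀ n, 1 ≤ n → d.lb1 G a n = 0)

end SPVAData
/-- The data of an `N=2` SUSY Poisson vertex algebra structure: a
`ℤ/2`-grading, the even derivation `∂ = der`, two odd derivations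
`D = sder1`, `D̃ = sder2`, and the `Λ`-bracket
`{a_Λ b} = ∑_n (λⁿ/n!)(a_{(n|00)}b - χ a_{(n|10)}b + χ̃ a_{(n|01)}b
- χχ̃ a_{(n|11)}b)`, with components `lb00, lb10, lb01, lb11`. -/
structure S2PVAData (P : Type) [Ring P] [Algebra ℂ P] where
  part : ZMod 2 → Submodule ℂ P
  der : P →ₗ[ℂ] P
  sder1 : P →ₗ[ℂ] P
  sder2 : P →ₗ[ℂ] P
  lb00 : P →ₗ[ℂ] P →ₗ[ℂ] (ℕ → P)
  lb10 : P →ₗ[ℂ] P →ₗ[ℂ] (ℕ → P)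
  lb01 : P →ₗ[ℂ] P →ₗ[ℂ] (ℕ → P)
  lb11 : P →ₗ[ℂ] P →ₗ[ℂ] (ℕ → P)
  bnd : P → P → ℕ

namespace S2PVAData

variable {P : Type} [Ring P] [Algebra ℂ P] (d : S2PVAData P)

/-- The underlying `N=0` Poisson vertex algebra data, with `λ`-bracket the
`(n|11)`-component of the `Λ`-bracket. -/
def toPVAData : PVAData P :=
  { part := d.part, der := d.der, lb := d.lb11, bnd := d.bnd }

/-- The axioms of an `N=2` SUSY Poisson vertex algebra.  By the sesquilinearity
of the `Λ`-bracket, an `N=2` SUSY PVA structure is equivalent to the data of a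
Poisson vertex algebra structure for the `λ`-bracket
`{a_λ b} = ∑ (λⁿ/n!) a_{(n|11)} b` together with two supercommuting odd
derivations `D, D̃` with `D² = D̃² = ∂`, both compatible with the `λ`-bracket,
the remaining components being recovered by
`{a_Λ b} = {D̃Da_λ b} - χ{D̃a_λ b} + χ̃{Da_λ b} - χχ̃{a_λ b}`;
this is the form in which we state the axioms. -/
structure IsS2PVA : Prop where
  pva : d.toPVAData.IsPVA
  sder1_mem : ∀ (i : ZMod 2), ∀ a ∈ d.part i, d.sder1 a ∈ d.part (i + 1)
  sder2_mem : ∀ (i : ZMod 2), ∀ a ∈ d.part i, d.sder2 a ∈ d.part (i + 1)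
  sder1_mul : ∀ (i : ZMod 2), ∀ a ∈ d.part i, ∀ b : P,
    d.sder1 (a * b) = d.sder1 a * b + sg1 i • (a * d.sder1 b)
  sder2_mul : ∀ (i : ZMod 2), ∀ a ∈ d.part i, ∀ b : P,
    d.sder2 (a * b) = d.sder2 a * b + sg1 i • (a * d.sder2 b)
  sder1_sq : ∀ a : P, d.sder1 (d.sder1 a) = d.der a
  sder2_sq : ∀ a : P, d.sder2 (d.sder2 a) = d.der a
  anticomm : ∀ a : P, d.sder1 (d.sder2 a) + d.sder2 (d.sder1 a) = 0
  sder1_lb : ∀ (i : ZMod 2), ∀ a ∈ d.part i, ∀ (b : P) (n : ℕ),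
    d.sder1 (d.lb11 a b n) = d.lb11 (d.sder1 a) b n + sg1 i • d.lb11 a (d.sder1 b) n
  sder2_lb : ∀ (i : ZMod 2), ∀ a ∈ d.part i, ∀ (b : P) (n : ℕ),
    d.sder2 (d.lb11 a b n) = d.lb11 (d.sder2 a) b n + sg1 i • d.lb11 a (d.sder2 b) n
  comp01 : ∀ (a b : P) (n : ℕ), d.lb01 a b n = d.lb11 (d.sder1 a) b n
  comp10 : ∀ (a b : P) (n : ℕ), d.lb10 a b n = d.lb11 (d.sder2 a) b n
  comp00 : ∀ (a b : P) (n : ℕ), d.lb00 a b n = d.lb11 (d.sder2 (d.sder1 a)) b n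

/-- The conformal weight space of quasi-primary vectors for a candidate
`N=2` superconformal vector `J`: elements `a` with
`{J_Λ a} = (2∂ + 2Δλ + χD + χ̃D̃)a + O(Λ²)`. -/
def s2confWtSet (J : P) (Δ : ℝ) : Set P :=
  {a | d.lb00 J a 0 = (2 : ℂ) • d.der a ∧
       d.lb00 J a 1 = ((2 * Δ : ℝ) : ℂ) • a ∧
       d.lb10 J a 0 = -d.sder1 a ∧
       d.lb01 J a 0 = d.sder2 a}

/-- The `N=2` superconformal self-bracket relation
`{J_Λ J} = (2∂ + 2λ + χD + χ̃D̃)J + (λχχ̃/3)c` of Definition 3.4 (i),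
in components. -/
def SelfBracketRel (J : P) (c : ℂ) : Prop :=
  d.lb00 J J 0 = (2 : ℂ) • d.der J ∧
  d.lb00 J J 1 = (2 : ℂ) • J ∧
  (∀ n, 2 ≤ n → d.lb00 J J n = 0) ∧
  d.lb10 J J 0 = -d.sder1 J ∧
  (∀ n, 1 ≤ n → d.lb10 J J n = 0) ∧
  d.lb01 J J 0 = d.sder2 J ∧
  (∀ n, 1 ≤ n → d.lb01 J J n = 0) ∧
  d.lb11 J J 0 = 0 ∧
  d.lb11 J J 1 = (-(c / 3)) • (1 : P) ∧
  (∀ n, 2 ≤ n → d.lb11 J J n = 0)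

/-- `J` is an `N=2` superconformal vector of central charge `c`. -/
def IsSuperconformal (J : P) (c : ℂ) : Prop :=
  J ∈ d.part 0 ∧ d.SelfBracketRel J c ∧
  ∃ M : ℝ, (∀ Δ : ℝ, Δ < M → d.s2confWtSet J Δ ⊆ {0}) ∧
    Submodule.span ℂ (⋃ Δ : ℝ, d.s2confWtSet J Δ) = ⊤

/-- `a` is primary of conformal weight `Δ` with respect to the `N=2`
superconformal vector `J`: `{J_Λ a} = (2∂ + 2Δλ + χD + χ̃D̃)a` exactly. -/
def IsPrimary (J a : P) (Δ : ℝ) : Prop :=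
  d.lb00 J a 0 = (2 : ℂ) • d.der a ∧
  d.lb00 J a 1 = ((2 * Δ : ℝ) : ℂ) • a ∧
  (∀ n, 2 ≤ n → d.lb00 J a n = 0) ∧
  d.lb10 J a 0 = -d.sder1 a ∧
  (∀ n, 1 ≤ n → d.lb10 J a n = 0) ∧
  d.lb01 J a 0 = d.sder2 a ∧
  (∀ n, 1 ≤ n → d.lb01 J a n = 0) ∧
  (∀ n, d.lb11 J a n = 0)

end S2PVAData
/-- The `N=0` Poisson vertex algebra data induced from an `N=1` SUSY PVA
structure: the `λ`-bracket is `{a_λ b} = ∑ (λⁿ/n!) a_{(n|1)} b`. -/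
def SPVAData.toPVAData {P : Type} [Ring P] [Algebra ℂ P] (d : SPVAData P) :
    PVAData P :=
  { part := d.part, der := d.der, lb := d.lb1, bnd := d.bnd }

/-- The first `N=1` SUSY PVA data induced from an `N=2` SUSY PVA structure:
`{a_Λ b} = ∑ (λⁿ/n!)(a_{(n|01)}b + χ a_{(n|11)}b)`, with odd derivation `D`. -/
def S2PVAData.toSPVAData₁ {P : Type} [Ring P] [Algebra ℂ P] (d : S2PVAData P) :
    SPVAData P :=
  { part := d.part, der := d.der, sder := d.sder1,
    lb0 := d.lb01, lb1 := d.lb11, bnd := d.bnd }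

/-- The second `N=1` SUSY PVA data induced from an `N=2` SUSY PVA structure:
`{a_Λ̃ b} = ∑ (λⁿ/n!)(a_{(n|10)}b + χ̃ a_{(n|11)}b)`, with odd derivation `D̃`. -/
def S2PVAData.toSPVAData₂ {P : Type} [Ring P] [Algebra ℂ P] (d : S2PVAData P) :
    SPVAData P :=
  { part := d.part, der := d.der, sder := d.sder2,
    lb0 := d.lb10, lb1 := d.lb11, bnd := d.bnd }

/-- The `N=1` SUSY bracket data induced from a `λ`-bracket and an odd
endomorphism `D`: `{a_Λ b}⁻ = {Da_λ b} + χ{a_λ b}`. -/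
def PVAData.inducedSPVA {P : Type} [Ring P] [Algebra ℂ P] (d : PVAData P)
    (D : P →ₗ[ℂ] P) : SPVAData P :=
  { part := d.part, der := d.der, sder := D,
    lb0 := d.lb.comp D, lb1 := d.lb,
    bnd := fun a b => max (d.bnd (D a) b) (d.bnd a b) }

/-- The `N=2` SUSY bracket data induced from a `λ`-bracket and two odd
endomorphisms `D, D̃`:
`{a_Λ b}⁻ = {D̃Da_λ b} - χ{D̃a_λ b} + χ̃{Da_λ b} - χχ̃{a_λ b}`. -/
def PVAData.inducedS2PVA {P : Type} [Ring P] [Algebra ℂ P] (d : PVAData P)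
    (D Dt : P →ₗ[ℂ] P) : S2PVAData P :=
  { part := d.part, der := d.der, sder1 := D, sder2 := Dt,
    lb00 := d.lb.comp (Dt ∘ₗ D), lb10 := d.lb.comp Dt,
    lb01 := d.lb.comp D, lb11 := d.lb,
    bnd := fun a b =>
      max (max (d.bnd (Dt (D a)) b) (d.bnd (Dt a) b))
        (max (d.bnd (D a) b) (d.bnd a b)) }
/-- The target axioms: `(A, part, der)` is a unital supercommutative
associative differential `ℂ`-superalgebra with even derivation `der`. -/
def SuperDiffTargetOK (A : Type) [Ring A] [Algebra ℂ A]
    (part : ZMod 2 → Submodule ℂ A) (der : A →ₗ[ℂ] A) : Prop :=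
  IsCompl (part 0) (part 1) ∧ (1 : A) ∈ part 0 ∧
  (∀ (i j : ZMod 2), ∀ a ∈ part i, ∀ b ∈ part j, a * b ∈ part (i + j)) ∧
  (∀ (i j : ZMod 2), ∀ a ∈ part i, ∀ b ∈ part j, a * b = sg i j • (b * a)) ∧
  (∀ (i : ZMod 2), ∀ a ∈ part i, der a ∈ part i) ∧
  (∀ a b : A, der (a * b) = der a * b + a * der b)

/-- `(A, part)` has an odd derivation `sd` with `sd² = der`. -/
def OddDerOK (A : Type) [Ring A] [Algebra ℂ A]
    (part : ZMod 2 → Submodule ℂ A) (der sd : A →ₗ[ℂ] A) : Prop :=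
  (∀ (i : ZMod 2), ∀ a ∈ part i, sd a ∈ part (i + 1)) ∧
  (∀ (i : ZMod 2), ∀ a ∈ part i, ∀ b : A,
    sd (a * b) = sd a * b + sg1 i • (a * sd b)) ∧
  (∀ a : A, sd (sd a) = der a)

/-- The family `x : ι → P` (of parities `px`) freely generates `P` as a
`ℂ[∂]`-differential superalgebra: universal property with respect to unital
supercommutative associative differential `ℂ`-superalgebras. -/
def FreelyGenerates₀ (P : Type) [Ring P] [Algebra ℂ P]
    (part : ZMod 2 → Submodule ℂ P) (der : P →ₗ[ℂ] P)
    {ι : Type} (x : ι → P) (px : ι → ZMod 2) : Prop :=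
  ∀ (A : Type) [Ring A] [Algebra ℂ A], ∀ (pA : ZMod 2 → Submodule ℂ A)
    (dA : A →ₗ[ℂ] A), SuperDiffTargetOK A pA dA →
    ∀ y : ι → A, (∀ i, y i ∈ pA (px i)) →
    ∃! φ : P →ₐ[ℂ] A, (∀ i, φ (x i) = y i) ∧
      (∀ p : P, φ (der p) = dA (φ p)) ∧
      (∀ j : ZMod 2, ∀ a ∈ part j, φ a ∈ pA j)

/-- The family `x : ι → P` (of parities `px`) freely generates `P` as a
`ℂ[∂,D] = ℂ[∇]`-differential superalgebra (`N=1`): universal property with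
respect to supercommutative differential superalgebras with an odd derivation
`D` satisfying `D² = ∂`. -/
def FreelyGenerates₁ (P : Type) [Ring P] [Algebra ℂ P]
    (part : ZMod 2 → Submodule ℂ P) (der sder : P →ₗ[ℂ] P)
    {ι : Type} (x : ι → P) (px : ι → ZMod 2) : Prop :=
  ∀ (A : Type) [Ring A] [Algebra ℂ A], ∀ (pA : ZMod 2 → Submodule ℂ A)
    (dA sA : A →ₗ[ℂ] A), SuperDiffTargetOK A pA dA → OddDerOK A pA dA sA →
    ∀ y : ι → A, (∀ i, y i ∈ pA (px i)) →
    ∃! φ : P →ₐ[ℂ] A, (∀ i, φ (x i) = y i) ∧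
      (∀ p : P, φ (der p) = dA (φ p)) ∧
      (∀ p : P, φ (sder p) = sA (φ p)) ∧
      (∀ j : ZMod 2, ∀ a ∈ part j, φ a ∈ pA j)

/-- The family `x : ι → P` (of parities `px`) freely generates `P` as a
`ℂ[∂,D,D̃] = ℂ[∇]`-differential superalgebra (`N=2`): universal property with
respect to supercommutative differential superalgebras with two supercommuting
odd derivations `D, D̃` squaring to `∂`. -/
def FreelyGenerates₂ (P : Type) [Ring P] [Algebra ℂ P]
    (part : ZMod 2 → Submodule ℂ P) (der sder1 sder2 : P →ₗ[ℂ] P)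
    {ι : Type} (x : ι → P) (px : ι → ZMod 2) : Prop :=
  ∀ (A : Type) [Ring A] [Algebra ℂ A], ∀ (pA : ZMod 2 → Submodule ℂ A)
    (dA sA tA : A →ₗ[ℂ] A), SuperDiffTargetOK A pA dA →
    OddDerOK A pA dA sA → OddDerOK A pA dA tA →
    (∀ a : A, sA (tA a) + tA (sA a) = 0) →
    ∀ y : ι → A, (∀ i, y i ∈ pA (px i)) →
    ∃! φ : P →ₐ[ℂ] A, (∀ i, φ (x i) = y i) ∧
      (∀ p : P, φ (der p) = dA (φ p)) ∧
      (∀ p : P, φ (sder1 p) = sA (φ p)) ∧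
      (∀ p : P, φ (sder2 p) = tA (φ p)) ∧
      (∀ j : ZMod 2, ∀ a ∈ part j, φ a ∈ pA j)

/-- The operator `a ↦ G_{(0)} a` (zeroth coefficient of the `λ`-bracket with a
fixed element `G`), as a linear endomorphism. -/
def PVAData.ad0 {P : Type} [Ring P] [Algebra ℂ P] (d : PVAData P) (G : P) :
    P →ₗ[ℂ] P where
  toFun x := d.lb G x 0
  map_add' x y := by simp
  map_smul' c x := by simp

/-- The operator `a ↦ J_{(0|0)} a` (the `(0|0)`-coefficient of the
`Λ`-bracket with a fixed element `J`), as a linear endomorphism. -/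
def SPVAData.ad00 {P : Type} [Ring P] [Algebra ℂ P] (d : SPVAData P) (J : P) :
    P →ₗ[ℂ] P where
  toFun x := d.lb0 J x 0
  map_add' x y := by simp
  map_smul' c x := by simp

/-- The axioms of a unital supercommutative associative `ℂ`-superalgebra. -/
def SuperAlgTargetOK (A : Type) [Ring A] [Algebra ℂ A]
    (part : ZMod 2 → Submodule ℂ A) : Prop :=
  IsCompl (part 0) (part 1) ∧ (1 : A) ∈ part 0 ∧
  (∀ (i j : ZMod 2), ∀ a ∈ part i, ∀ b ∈ part j, a * b ∈ part (i + j)) ∧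
  (∀ (i j : ZMod 2), ∀ a ∈ part i, ∀ b ∈ part j, a * b = sg i j • (b * a))

/-- The data of an `N=1` SUSY Lie conformal algebra structure on a
`ℂ`-superspace `R` (same conventions as `SPVAData`, without the product). -/
structure SLCAData (R : Type) [AddCommGroup R] [Module ℂ R] where
  part : ZMod 2 → Submodule ℂ R
  der : R →ₗ[ℂ] R
  sder : R →ₗ[ℂ] R
  lb0 : R →ₗ[ℂ] R →ₗ[ℂ] (ℕ → R)
  lb1 : R →ₗ[ℂ] R →ₗ[ℂ] (ℕ → R)
  bnd : R → R → ℕ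

namespace SLCAData

variable {R : Type} [AddCommGroup R] [Module ℂ R] (d : SLCAData R)

/-- The axioms of an `N=1` SUSY Lie conformal algebra: a `ℤ/2`-graded
`ℂ[∇]`-module with an odd `Λ`-bracket satisfying sesquilinearity,
skewsymmetry and the Jacobi identity (components as in `SPVAData.IsSPVA`). -/
structure IsSLCA : Prop where
  compl : IsCompl (d.part 0) (d.part 1)
  der_mem : ∀ (i : ZMod 2), ∀ a ∈ d.part i, d.der a ∈ d.part i
  sder_mem : ∀ (i : ZMod 2), ∀ a ∈ d.part i, d.sder a ∈ d.part (i + 1)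
  sder_sq : ∀ a : R, d.sder (d.sder a) = d.der a
  lb0_mem : ∀ (i j : ZMod 2), ∀ a ∈ d.part i, ∀ b ∈ d.part j, ∀ n,
    d.lb0 a b n ∈ d.part (i + j + 1)
  lb1_mem : ∀ (i j : ZMod 2), ∀ a ∈ d.part i, ∀ b ∈ d.part j, ∀ n,
    d.lb1 a b n ∈ d.part (i + j)
  lb0_bnd : ∀ a b n, d.bnd a b ≤ n → d.lb0 a b n = 0
  lb1_bnd : ∀ a b n, d.bnd a b ≤ n → d.lb1 a b n = 0
  sesq1₀ : ∀ a b : R, d.lb0 (d.sder a) b 0 = 0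
  sesq1 : ∀ (a b : R) (n : ℕ),
    d.lb0 (d.sder a) b (n + 1) = -((n + 1 : ℕ) : ℂ) • d.lb1 a b n
  sesq1' : ∀ (a b : R) (n : ℕ), d.lb1 (d.sder a) b n = d.lb0 a b n
  sesq2₀ : ∀ (i : ZMod 2), ∀ a ∈ d.part i, ∀ b : R,
    d.lb0 a (d.sder b) 0 = sg1 (i + 1) • d.sder (d.lb0 a b 0)
  sesq2 : ∀ (i : ZMod 2), ∀ a ∈ d.part i, ∀ (b : R) (n : ℕ),
    d.lb0 a (d.sder b) (n + 1) = sg1 (i + 1) •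
      (d.sder (d.lb0 a b (n + 1)) + ((n + 1 : ℕ) : ℂ) • d.lb1 a b n)
  sesq2' : ∀ (i : ZMod 2), ∀ a ∈ d.part i, ∀ (b : R) (n : ℕ),
    d.lb1 a (d.sder b) n = sg1 (i + 1) •
      (d.lb0 a b n - d.sder (d.lb1 a b n))
  skew0 : ∀ (i j : ZMod 2), ∀ a ∈ d.part i, ∀ b ∈ d.part j, ∀ n,
    d.lb0 a b n = sg i j • ∑ k ∈ Finset.range (d.bnd b a + 1),
      (((-1 : ℂ) ^ (n + k)) / (Nat.factorial k : ℂ)) •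
        (d.der ^ k) (d.lb0 b a (n + k) - d.sder (d.lb1 b a (n + k)))
  skew1 : ∀ (i j : ZMod 2), ∀ a ∈ d.part i, ∀ b ∈ d.part j, ∀ n,
    d.lb1 a b n = -sg i j • ∑ k ∈ Finset.range (d.bnd b a + 1),
      (((-1 : ℂ) ^ (n + k)) / (Nat.factorial k : ℂ)) •
        (d.der ^ k) (d.lb1 b a (n + k))
  jacobi00 : ∀ (i j : ZMod 2), ∀ a ∈ d.part i, ∀ b ∈ d.part j, ∀ (c : R)
    (m n : ℕ), d.lb0 a (d.lb0 b c n) m = sg1 (i + 1) •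
      ((∑ k ∈ Finset.range (m + 1),
        ((Nat.choose m k : ℕ) : ℂ) • d.lb0 (d.lb0 a b k) c (m + n - k)) +
       (∑ k ∈ Finset.range m,
        (((k + 1) * Nat.choose m (k + 1) : ℕ) : ℂ) •
          d.lb1 (d.lb1 a b k) c (m + n - k - 1))) +
      sg (i + 1) (j + 1) • d.lb0 b (d.lb0 a c m) n
  jacobi10 : ∀ (i j : ZMod 2), ∀ a ∈ d.part i, ∀ b ∈ d.part j, ∀ (c : R)
    (m n : ℕ), d.lb1 a (d.lb0 b c n) m = sg1 (i + 1) •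
      (∑ k ∈ Finset.range (m + 1), ((Nat.choose m k : ℕ) : ℂ) •
        (d.lb1 (d.lb0 a b k) c (m + n - k) - d.lb0 (d.lb1 a b k) c (m + n - k))) +
      (sg (i + 1) (j + 1) * sg1 (j + 1)) • d.lb0 b (d.lb1 a c m) n
  jacobi01 : ∀ (i j : ZMod 2), ∀ a ∈ d.part i, ∀ b ∈ d.part j, ∀ (c : R)
    (m n : ℕ), sg1 (i + 1) • d.lb0 a (d.lb1 b c n) m = sg1 (i + 1) •
      (∑ k ∈ Finset.range (m + 1),
        ((Nat.choose m k : ℕ) : ℂ) • d.lb1 (d.lb0 a b k) c (m + n - k)) +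
      sg (i + 1) (j + 1) • d.lb1 b (d.lb0 a c m) n
  jacobi11 : ∀ (i j : ZMod 2), ∀ a ∈ d.part i, ∀ b ∈ d.part j, ∀ (c : R)
    (m n : ℕ), sg1 i • d.lb1 a (d.lb1 b c n) m = sg1 i •
      (∑ k ∈ Finset.range (m + 1),
        ((Nat.choose m k : ℕ) : ℂ) • d.lb1 (d.lb1 a b k) c (m + n - k)) +
      (sg (i + 1) (j + 1) * sg1 (j + 1)) • d.lb1 b (d.lb1 a c m) n

end SLCAData

/-- The data of an `N=2` SUSY Lie conformal algebra structure on a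
`ℂ`-superspace `R` (same conventions as `S2PVAData`, without the product). -/
structure S2LCAData (R : Type) [AddCommGroup R] [Module ℂ R] where
  part : ZMod 2 → Submodule ℂ R
  der : R →ₗ[ℂ] R
  sder1 : R →ₗ[ℂ] R
  sder2 : R →ₗ[ℂ] R
  lb00 : R →ₗ[ℂ] R →ₗ[ℂ] (ℕ → R)
  lb10 : R →ₗ[ℂ] R →ₗ[ℂ] (ℕ → R)
  lb01 : R →ₗ[ℂ] R →ₗ[ℂ] (ℕ → R)
  lb11 : R →ₗ[ℂ] R →ₗ[ℂ] (ℕ → R)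
  bnd : R → R → ℕ

namespace S2LCAData

variable {R : Type} [AddCommGroup R] [Module ℂ R] (d : S2LCAData R)

/-- The axioms of an `N=2` SUSY Lie conformal algebra, in the equivalent
formulation via the induced `λ`-bracket `lb11` (an `N=0` Lie conformal
algebra bracket) together with two supercommuting odd operators `D, D̃`
squaring to `∂` and compatible with `lb11`, the other components being
`lb01 a b = lb11 (Da) b`, `lb10 a b = lb11 (D̃a) b`,
`lb00 a b = lb11 (D̃Da) b`. -/
structure IsS2LCA : Prop where
  compl : IsCompl (d.part 0) (d.part 1)
  der_mem : ∀ (i : ZMod 2), ∀ a ∈ d.part i, d.der a ∈ d.part i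
  sder1_mem : ∀ (i : ZMod 2), ∀ a ∈ d.part i, d.sder1 a ∈ d.part (i + 1)
  sder2_mem : ∀ (i : ZMod 2), ∀ a ∈ d.part i, d.sder2 a ∈ d.part (i + 1)
  sder1_sq : ∀ a : R, d.sder1 (d.sder1 a) = d.der a
  sder2_sq : ∀ a : R, d.sder2 (d.sder2 a) = d.der a
  anticomm : ∀ a : R, d.sder1 (d.sder2 a) + d.sder2 (d.sder1 a) = 0
  lb11_mem : ∀ (i j : ZMod 2), ∀ a ∈ d.part i, ∀ b ∈ d.part j, ∀ n,
    d.lb11 a b n ∈ d.part (i + j)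
  lb11_bnd : ∀ a b n, d.bnd a b ≤ n → d.lb11 a b n = 0
  sesq1₀ : ∀ a b : R, d.lb11 (d.der a) b 0 = 0
  sesq1 : ∀ (a b : R) (n : ℕ),
    d.lb11 (d.der a) b (n + 1) = -((n + 1 : ℕ) : ℂ) • d.lb11 a b n
  sesq2₀ : ∀ a b : R, d.lb11 a (d.der b) 0 = d.der (d.lb11 a b 0)
  sesq2 : ∀ (a b : R) (n : ℕ), d.lb11 a (d.der b) (n + 1) =
    d.der (d.lb11 a b (n + 1)) + ((n + 1 : ℕ) : ℂ) • d.lb11 a b n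
  skew : ∀ (i j : ZMod 2), ∀ a ∈ d.part i, ∀ b ∈ d.part j, ∀ n,
    d.lb11 a b n = -sg i j • ∑ k ∈ Finset.range (d.bnd b a + 1),
      (((-1 : ℂ) ^ (n + k)) / (Nat.factorial k : ℂ)) •
        (d.der ^ k) (d.lb11 b a (n + k))
  jacobi : ∀ (i j : ZMod 2), ∀ a ∈ d.part i, ∀ b ∈ d.part j, ∀ (c : R)
    (m n : ℕ), d.lb11 a (d.lb11 b c n) m =
      (∑ k ∈ Finset.range (m + 1),
        ((Nat.choose m k : ℕ) : ℂ) • d.lb11 (d.lb11 a b k) c (m + n - k)) +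
      sg i j • d.lb11 b (d.lb11 a c m) n
  sder1_lb : ∀ (i : ZMod 2), ∀ a ∈ d.part i, ∀ (b : R) (n : ℕ),
    d.sder1 (d.lb11 a b n) =
      d.lb11 (d.sder1 a) b n + sg1 i • d.lb11 a (d.sder1 b) n
  sder2_lb : ∀ (i : ZMod 2), ∀ a ∈ d.part i, ∀ (b : R) (n : ℕ),
    d.sder2 (d.lb11 a b n) =
      d.lb11 (d.sder2 a) b n + sg1 i • d.lb11 a (d.sder2 b) n
  comp01 : ∀ (a b : R) (n : ℕ), d.lb01 a b n = d.lb11 (d.sder1 a) b n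
  comp10 : ∀ (a b : R) (n : ℕ), d.lb10 a b n = d.lb11 (d.sder2 a) b n
  comp00 : ∀ (a b : R) (n : ℕ),
    d.lb00 a b n = d.lb11 (d.sder2 (d.sder1 a)) b n

end S2LCAData

/-- An `N=1` SUSY PVA structure on the free supercommutative superalgebra
`S(R)` over an `N=1` SUSY Lie conformal algebra `R`, whose `Λ`-bracket
extends that of `R` (by the Leibniz rule) and whose derivations extend those
of `R`. -/
structure FreeSPVAExtension {R : Type} [AddCommGroup R] [Module ℂ R]
    (dR : SLCAData R) where
  A : Type
  [ringA : Ring A]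
  [algA : Algebra ℂ A]
  dA : SPVAData A
  isSPVA : dA.IsSPVA
  emb : R →ₗ[ℂ] A
  emb_inj : Function.Injective emb
  emb_part : ∀ (i : ZMod 2), ∀ r ∈ dR.part i, emb r ∈ dA.part i
  emb_der : ∀ r, emb (dR.der r) = dA.der (emb r)
  emb_sder : ∀ r, emb (dR.sder r) = dA.sder (emb r)
  emb_lb0 : ∀ (r s : R) (n : ℕ), dA.lb0 (emb r) (emb s) n = emb (dR.lb0 r s n)
  emb_lb1 : ∀ (r s : R) (n : ℕ), dA.lb1 (emb r) (emb s) n = emb (dR.lb1 r s n)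
  -- `A = S(R)`: universal property of the free supercommutative superalgebra
  free : ∀ (B : Type) [Ring B] [Algebra ℂ B],
    ∀ (pB : ZMod 2 → Submodule ℂ B), SuperAlgTargetOK B pB →
    ∀ f : R →ₗ[ℂ] B, (∀ (i : ZMod 2), ∀ r ∈ dR.part i, f r ∈ pB i) →
    ∃! φ : A →ₐ[ℂ] B, (∀ r, φ (emb r) = f r) ∧
      (∀ (j : ZMod 2), ∀ x ∈ dA.part j, φ x ∈ pB j)

/-- An `N=2` SUSY PVA structure on the free supercommutative superalgebra
`S(R)` over an `N=2` SUSY Lie conformal algebra `R`, extending the structure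
of `R`. -/
structure FreeS2PVAExtension {R : Type} [AddCommGroup R] [Module ℂ R]
    (dR : S2LCAData R) where
  A : Type
  [ringA : Ring A]
  [algA : Algebra ℂ A]
  dA : S2PVAData A
  isS2PVA : dA.IsS2PVA
  emb : R →ₗ[ℂ] A
  emb_inj : Function.Injective emb
  emb_part : ∀ (i : ZMod 2), ∀ r ∈ dR.part i, emb r ∈ dA.part i
  emb_der : ∀ r, emb (dR.der r) = dA.der (emb r)
  emb_sder1 : ∀ r, emb (dR.sder1 r) = dA.sder1 (emb r)
  emb_sder2 : ∀ r, emb (dR.sder2 r) = dA.sder2 (emb r)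
  emb_lb00 : ∀ (r s : R) (n : ℕ), dA.lb00 (emb r) (emb s) n = emb (dR.lb00 r s n)
  emb_lb10 : ∀ (r s : R) (n : ℕ), dA.lb10 (emb r) (emb s) n = emb (dR.lb10 r s n)
  emb_lb01 : ∀ (r s : R) (n : ℕ), dA.lb01 (emb r) (emb s) n = emb (dR.lb01 r s n)
  emb_lb11 : ∀ (r s : R) (n : ℕ), dA.lb11 (emb r) (emb s) n = emb (dR.lb11 r s n)
  free : ∀ (B : Type) [Ring B] [Algebra ℂ B],
    ∀ (pB : ZMod 2 → Submodule ℂ B), SuperAlgTargetOK B pB →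
    ∀ f : R →ₗ[ℂ] B, (∀ (i : ZMod 2), ∀ r ∈ dR.part i, f r ∈ pB i) →
    ∃! φ : A →ₐ[ℂ] B, (∀ r, φ (emb r) = f r) ∧
      (∀ (j : ZMod 2), ∀ x ∈ dA.part j, φ x ∈ pB j)

open Polynomial

theorem sg_eq_or (i j : ZMod 2) : sg i j = 1 ∨ sg i j = -1 := by
  unfold sg
  exact neg_one_pow_eq_or ℂ _

theorem sg_comm (i j : ZMod 2) : sg i j = sg j i := by
  unfold sg
  rw [mul_comm]

theorem sg_add_right (i j k : ZMod 2) : sg i (j + k) = sg i j * sg i k := by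
  have hv : ∀ i j k : ZMod 2, (i.val * (j + k).val) % 2 = (i.val * j.val + i.val * k.val) % 2 := by
    decide
  unfold sg
  rw [← pow_add, neg_one_pow_eq_pow_mod_two, hv, ← neg_one_pow_eq_pow_mod_two]

theorem sg_add_left (i j k : ZMod 2) : sg (i + j) k = sg i k * sg j k := by
  rw [sg_comm, sg_add_right, sg_comm k i, sg_comm k j]

@[simp]
theorem sg_zero_left (i : ZMod 2) : sg 0 i = 1 := by simp [sg]

@[simp]
theorem sg_zero_right (i : ZMod 2) : sg i 0 = 1 := by simp [sg]

@[simp]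
theorem sg_mul_self (i j : ZMod 2) : sg i j * sg i j = 1 := by
  rcases sg_eq_or i j with h | h <;> simp [h]

theorem sg_one_left (i : ZMod 2) : sg 1 i = sg1 i := by
  simp [sg, sg1, ZMod.val_one]

theorem zmod_two_cases (i : ZMod 2) : i = 0 ∨ i = 1 := by
  revert i
  decide

theorem zmod_two_add_self (i : ZMod 2) : i + i = 0 := CharTwo.add_self_eq_zero i

theorem eq_zero_of_sg_smul_eq {V : Type*} [AddCommGroup V] [Module ℂ V] {x : V}
    (h : sg 1 0 • x = sg 1 1 • x) : x = 0 := by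
  have h1 : sg 1 1 = -1 := by simp [sg_one_left, sg1, ZMod.val_one]
  rw [sg_zero_right, h1, one_smul, neg_one_smul] at h
  have h2 : (2 : ℂ) • x = 0 := by
    rw [two_smul]
    nth_rewrite 1 [h]
    simp
  exact (smul_eq_zero.1 h2).resolve_left two_ne_zero

/-- A submodule containing the even and the odd part is everything. -/
theorem mem_of_parts {V : Type*} [AddCommGroup V] [Module ℂ V]
    {p : ZMod 2 → Submodule ℂ V} (hp : IsCompl (p 0) (p 1)) {Q : Submodule ℂ V}
    (h : ∀ i, p i ≤ Q) (v : V) : v ∈ Q := by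
  have h0 : ⊤ ≤ Q := by
    rw [← hp.sup_eq_top]
    exact sup_le (h 0) (h 1)
  exact h0 Submodule.mem_top

/-- Linear maps may be prescribed separately on the even and on the odd part. -/
theorem exists_linearMap_of_parts {V W : Type*} [AddCommGroup V] [Module ℂ V] [AddCommGroup W]
    [Module ℂ W] {p : ZMod 2 → Submodule ℂ V} (hp : IsCompl (p 0) (p 1))
    (f : ∀ i, p i →ₗ[ℂ] W) : ∃ g : V →ₗ[ℂ] W, ∀ i, ∀ v (hv : v ∈ p i), g v = f i ⟨v, hv⟩ := by
  refine ⟨LinearMap.ofIsCompl hp (f 0) (f 1), fun i v hv => ?_⟩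
  obtain rfl | rfl : i = 0 ∨ i = 1 := zmod_two_cases i
  · exact LinearMap.ofIsCompl_apply_left hp ⟨v, hv⟩
  · exact LinearMap.ofIsCompl_apply_right hp ⟨v, hv⟩

/-- The linear map multiplying a homogeneous vector of parity `j` by `(-1)^{ij}`. -/
theorem exists_parity_twist {V : Type*} [AddCommGroup V] [Module ℂ V]
    {p : ZMod 2 → Submodule ℂ V} (hp : IsCompl (p 0) (p 1)) (i : ZMod 2) :
    ∃ τ : V →ₗ[ℂ] V, ∀ j, ∀ v ∈ p j, τ v = sg i j • v := by
  obtain ⟨τ, hτ⟩ := exists_linearMap_of_parts hp (fun j => sg i j • (p j).subtype)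
  exact ⟨τ, fun j v hv => by simp [hτ j v hv]⟩

/-- `S`, with grading `gr`, is the free supercommutative superalgebra on the superspace `R`
with grading `part`. -/
structure IsFreeSuper {R : Type} [AddCommGroup R] [Module ℂ R] (part : ZMod 2 → Submodule ℂ R)
    {S : Type} [Ring S] [Algebra ℂ S] (gr : ZMod 2 → Submodule ℂ S) (ι : R →ₗ[ℂ] S) : Prop where
  compl : IsCompl (gr 0) (gr 1)
  one_mem : (1 : S) ∈ gr 0
  mul_mem : ∀ i j, ∀ a ∈ gr i, ∀ b ∈ gr j, a * b ∈ gr (i + j)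
  scomm : ∀ i j, ∀ a ∈ gr i, ∀ b ∈ gr j, a * b = sg i j • (b * a)
  ι_mem : ∀ i, ∀ r ∈ part i, ι r ∈ gr i
  induct : ∀ Q : Submodule ℂ S, 1 ∈ Q →
    (∀ i, ∀ r ∈ part i, ∀ x ∈ Q, ι r * x ∈ Q) → ∀ x, x ∈ Q
  lift : ∀ (E : Type) [Ring E] [Algebra ℂ E] (f : R →ₗ[ℂ] E),
    (∀ i j, ∀ a ∈ part i, ∀ b ∈ part j, f a * f b = sg i j • (f b * f a)) →
    ∃ φ : S →ₐ[ℂ] E, ∀ r, φ (ι r) = f r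

/-- Induction on homogeneous elements of a superalgebra generated by homogeneous elements. -/
theorem homog_induct_of_generated {R : Type} [AddCommGroup R] [Module ℂ R]
    {part : ZMod 2 → Submodule ℂ R} {S : Type} [Ring S] [Algebra ℂ S]
    {gr : ZMod 2 → Submodule ℂ S} {ι : R →ₗ[ℂ] S}
    (compl : IsCompl (gr 0) (gr 1)) (one_mem : (1 : S) ∈ gr 0)
    (mul_mem : ∀ i j, ∀ a ∈ gr i, ∀ b ∈ gr j, a * b ∈ gr (i + j))
    (ι_mem : ∀ i, ∀ r ∈ part i, ι r ∈ gr i)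
    (induct : ∀ Q : Submodule ℂ S, 1 ∈ Q →
      (∀ i, ∀ r ∈ part i, ∀ x ∈ Q, ι r * x ∈ Q) → ∀ x, x ∈ Q)
    (Q : ZMod 2 → Submodule ℂ S) (h1 : 1 ∈ Q 0)
    (hQ : ∀ i j, ∀ r ∈ part i, ∀ x ∈ gr j, x ∈ Q j → ι r * x ∈ Q (i + j)) (i : ZMod 2) (x : S)
    (hx : x ∈ gr i) : x ∈ Q i := by
  have key : x ∈ (Q 0 ⊓ gr 0) ⊔ (Q 1 ⊓ gr 1) := by
    refine induct _ (Submodule.mem_sup_left (Submodule.mem_inf.2 ⟨h1, one_mem⟩))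
      (fun i r hr x hx => ?_) x
    obtain ⟨y, hy, z, hz, rfl⟩ := Submodule.mem_sup.1 hx
    have hy' : ι r * y ∈ Q (i + 0) ⊓ gr (i + 0) :=
      ⟨hQ i 0 r hr y hy.2 hy.1, mul_mem i 0 _ (ι_mem i r hr) y hy.2⟩
    have hz' : ι r * z ∈ Q (i + 1) ⊓ gr (i + 1) :=
      ⟨hQ i 1 r hr z hz.2 hz.1, mul_mem i 1 _ (ι_mem i r hr) z hz.2⟩
    rw [mul_add]
    obtain rfl | rfl : i = 0 ∨ i = 1 := zmod_two_cases i
    · exact Submodule.add_mem_sup hy' hz'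
    · rw [add_comm]
      exact Submodule.add_mem_sup hz' hy'
  obtain ⟨y, hy, z, hz, rfl⟩ := Submodule.mem_sup.1 key
  have hdisj := Submodule.disjoint_def.1 compl.disjoint
  obtain rfl | rfl : i = 0 ∨ i = 1 := zmod_two_cases i
  · have hz0 : z = 0 := hdisj z (by simpa using (gr 0).sub_mem hx hy.2) hz.2
    simpa [hz0] using hy.1
  · have hy0 : y = 0 := hdisj y hy.2 (by simpa using (gr 1).sub_mem hx hz.2)
    simpa [hy0] using hz.1

section Construction

variable {R : Type} [AddCommGroup R] [Module ℂ R] (part : ZMod 2 → Submodule ℂ R)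

/-- The supercommutativity relations on the tensor algebra. -/
inductive SuperRel : TensorAlgebra ℂ R → TensorAlgebra ℂ R → Prop
  | comm (i j : ZMod 2) (a b : R) (ha : a ∈ part i) (hb : b ∈ part j) :
      SuperRel (TensorAlgebra.ι ℂ a * TensorAlgebra.ι ℂ b)
        (sg i j • (TensorAlgebra.ι ℂ b * TensorAlgebra.ι ℂ a))

/-- The free supercommutative superalgebra on a superspace. -/
abbrev SuperSym : Type := RingQuot (SuperRel part)

/-- The inclusion of generators. -/
def superSymι : R →ₗ[ℂ] SuperSym part :=
  (RingQuot.mkAlgHom ℂ (SuperRel part)).toLinearMap ∘ₗ TensorAlgebra.ι ℂ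

theorem superSymι_comm (i j : ZMod 2) (a b : R) (ha : a ∈ part i) (hb : b ∈ part j) :
    superSymι part a * superSymι part b =
      sg i j • (superSymι part b * superSymι part a) := by
  have h := RingQuot.mkAlgHom_rel ℂ (SuperRel.comm (part := part) i j a b ha hb)
  simpa [superSymι] using h

theorem superSym_lift (E : Type) [Ring E] [Algebra ℂ E] (f : R →ₗ[ℂ] E)
    (hf : ∀ i j, ∀ a ∈ part i, ∀ b ∈ part j, f a * f b = sg i j • (f b * f a)) :
    ∃ φ : SuperSym part →ₐ[ℂ] E, ∀ r, φ (superSymι part r) = f r := by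
  refine ⟨RingQuot.liftAlgHom ℂ ⟨TensorAlgebra.lift ℂ f, ?_⟩, fun r => ?_⟩
  · rintro _ _ ⟨i, j, a, b, ha, hb⟩
    simpa using hf i j a ha b hb
  · simp [superSymι]

variable {part}

theorem superSym_induct (hp : IsCompl (part 0) (part 1)) (Q : Submodule ℂ (SuperSym part))
    (h1 : 1 ∈ Q) (hQ : ∀ i, ∀ r ∈ part i, ∀ x ∈ Q, superSymι part r * x ∈ Q)
    (x : SuperSym part) : x ∈ Q := by
  have hmul : ∀ r : R, ∀ x ∈ Q, superSymι part r * x ∈ Q := fun r x hx =>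
    mem_of_parts hp
      (Q := Q.comap (LinearMap.mulRight ℂ x ∘ₗ superSymι part)) (fun i r hr => hQ i r hr x hx) r
  have key : ∀ t : TensorAlgebra ℂ R, ∀ x ∈ Q, RingQuot.mkAlgHom ℂ (SuperRel part) t * x ∈ Q := by
    intro t
    induction t using TensorAlgebra.induction with
    | algebraMap c =>
      intro x hx
      rw [AlgHom.commutes, ← Algebra.smul_def]
      exact Q.smul_mem c hx
    | ι r => exact fun x hx => hmul r x hx
    | mul a b ha hb =>
      intro x hx
      rw [map_mul, mul_assoc]
      exact ha _ (hb _ hx)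
    | add a b ha hb =>
      intro x hx
      rw [map_add, add_mul]
      exact Q.add_mem (ha _ hx) (hb _ hx)
  obtain ⟨t, rfl⟩ := RingQuot.mkAlgHom_surjective ℂ (SuperRel part) x
  simpa using key t 1 h1

variable (part)

/-- The part of given parity in the free supercommutative superalgebra. -/
def superSymGr (i : ZMod 2) : Submodule ℂ (SuperSym part) :=
  ⨅ φ : {φ : SuperSym part →ₐ[ℂ] SuperSym part //
      ∀ j, ∀ r ∈ part j, φ (superSymι part r) = sg 1 j • superSymι part r},
    LinearMap.eqLocus φ.1.toLinearMap (sg 1 i • LinearMap.id)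

theorem mem_superSymGr {i : ZMod 2} {x : SuperSym part} :
    x ∈ superSymGr part i ↔ ∀ φ : SuperSym part →ₐ[ℂ] SuperSym part,
      (∀ j, ∀ r ∈ part j, φ (superSymι part r) = sg 1 j • superSymι part r) →
        φ x = sg 1 i • x := by
  simp [superSymGr, Submodule.mem_iInf]

variable {part}

theorem isFreeSuper_superSym (hp : IsCompl (part 0) (part 1)) :
    IsFreeSuper part (superSymGr part) (superSymι part) := by
  have hmul : ∀ i j, ∀ a ∈ superSymGr part i, ∀ b ∈ superSymGr part j,
      a * b ∈ superSymGr part (i + j) := by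
    intro i j a ha b hb
    rw [mem_superSymGr] at *
    intro φ hφ
    rw [map_mul, ha φ hφ, hb φ hφ, sg_add_right, smul_mul_smul_comm]
  have hone : (1 : SuperSym part) ∈ superSymGr part 0 := by
    rw [mem_superSymGr]
    intro φ hφ
    simp
  have hι : ∀ i, ∀ r ∈ part i, superSymι part r ∈ superSymGr part i := by
    intro i r hr
    rw [mem_superSymGr]
    exact fun φ hφ => hφ i r hr
  have hcompl : IsCompl (superSymGr part 0) (superSymGr part 1) := by
    constructor
    · rw [Submodule.disjoint_def]
      intro x hx0 hx1
      obtain ⟨τ, hτ⟩ := exists_parity_twist hp 1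
      obtain ⟨φ, hφ⟩ := superSym_lift part (SuperSym part) (superSymι part ∘ₗ τ) (by
        intro i j a ha b hb
        simp only [LinearMap.comp_apply, hτ i a ha, hτ j b hb, map_smul, smul_mul_smul_comm,
          superSymι_comm part i j a b ha hb, smul_smul]
        ring_nf)
      have hφ' : ∀ j, ∀ r ∈ part j, φ (superSymι part r) = sg 1 j • superSymι part r := by
        intro j r hr
        rw [hφ, LinearMap.comp_apply, hτ j r hr, map_smul]
      have h0 := (mem_superSymGr part).1 hx0 φ hφ'
      have h1 := (mem_superSymGr part).1 hx1 φ hφ'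
      rw [h0] at h1
      exact eq_zero_of_sg_smul_eq h1
    · rw [codisjoint_iff, eq_top_iff]
      intro x _
      refine superSym_induct hp _ (Submodule.mem_sup_left hone) (fun i r hr x hx => ?_) x
      obtain ⟨y, hy, z, hz, rfl⟩ := Submodule.mem_sup.1 hx
      rw [mul_add]
      have hy' := hmul i 0 _ (hι i r hr) y hy
      have hz' := hmul i 1 _ (hι i r hr) z hz
      obtain rfl | rfl : i = 0 ∨ i = 1 := zmod_two_cases i
      · exact Submodule.add_mem_sup hy' hz'
      · rw [add_comm]
        exact Submodule.add_mem_sup hz' hy'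
  refine ⟨hcompl, hone, hmul, fun i j a ha b hb => ?_, hι, superSym_induct hp, superSym_lift part⟩
  have hgen : ∀ i, ∀ r ∈ part i, ∀ j, ∀ b ∈ superSymGr part j,
      superSymι part r * b = sg i j • (b * superSymι part r) := by
    intro i r hr
    refine homog_induct_of_generated hcompl hone hmul hι (superSym_induct hp)
      (fun j => LinearMap.eqLocus (LinearMap.mulLeft ℂ (superSymι part r))
        (sg i j • LinearMap.mulRight ℂ (superSymι part r))) (by simp) ?_
    intro k j s hs x _ hx
    simp only [LinearMap.mem_eqLocus, LinearMap.mulLeft_apply, LinearMap.smul_apply,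
      LinearMap.mulRight_apply] at hx ⊢
    rw [← mul_assoc, superSymι_comm part i k r s hr hs, smul_mul_assoc, mul_assoc, hx,
      mul_smul_comm, smul_smul, sg_add_right, mul_assoc]
  refine homog_induct_of_generated hcompl hone hmul hι (superSym_induct hp)
    (fun i => LinearMap.eqLocus (LinearMap.mulRight ℂ b) (sg i j • LinearMap.mulLeft ℂ b))
    (by simp) ?_ i a ha
  intro k i r hr x _ hx
  simp only [LinearMap.mem_eqLocus, LinearMap.mulLeft_apply, LinearMap.smul_apply,
    LinearMap.mulRight_apply] at hx ⊢
  rw [mul_assoc, hx, mul_smul_comm, ← mul_assoc, hgen k r hr j b hb, smul_mul_assoc, smul_smul,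
    sg_add_left, mul_comm (sg i j), mul_assoc]

end Construction

namespace IsFreeSuper

variable {R : Type} [AddCommGroup R] [Module ℂ R] {part : ZMod 2 → Submodule ℂ R}
  {S : Type} [Ring S] [Algebra ℂ S] {gr : ZMod 2 → Submodule ℂ S} {ι : R →ₗ[ℂ] S}

/-- Induction on homogeneous elements of the free supercommutative superalgebra. -/
theorem homog_induct (H : IsFreeSuper part gr ι) (Q : ZMod 2 → Submodule ℂ S) (h1 : 1 ∈ Q 0)
    (hQ : ∀ i j, ∀ r ∈ part i, ∀ x ∈ gr j, x ∈ Q j → ι r * x ∈ Q (i + j)) (i : ZMod 2) (x : S)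
    (hx : x ∈ gr i) : x ∈ Q i :=
  homog_induct_of_generated H.compl H.one_mem H.mul_mem H.ι_mem H.induct Q h1 hQ i x hx

theorem injective_ι (H : IsFreeSuper part gr ι) : Function.Injective ι := by
  let _ : Module ℂᵐᵒᵖ R := Module.compHom _ ((RingHom.id ℂ).fromOpposite mul_comm)
  have _ : IsCentralScalar ℂ R := ⟨fun r m => rfl⟩
  obtain ⟨φ, hφ⟩ := H.lift (TrivSqZeroExt ℂ R) (TrivSqZeroExt.inrHom ℂ R) (by
    intro i j a _ b _
    simp)
  intro r s hrs
  have h := congrArg φ hrs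
  rw [hφ, hφ] at h
  exact TrivSqZeroExt.inr_injective h

end IsFreeSuper

/-- `Δ` is a superderivation of parity `i` along the algebra homomorphism `φ`. -/
def IsSDer {S E : Type} [Ring S] [Algebra ℂ S] [Ring E] [Algebra ℂ E]
    (gr : ZMod 2 → Submodule ℂ S) (φ : S →ₐ[ℂ] E) (i : ZMod 2) (Δ : S →ₗ[ℂ] E) : Prop :=
  ∀ j, ∀ b ∈ gr j, ∀ c, Δ (b * c) = Δ b * φ c + sg i j • (φ b * Δ c)

namespace IsSDer

variable {R : Type} [AddCommGroup R] [Module ℂ R] {part : ZMod 2 → Submodule ℂ R}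
  {S : Type} [Ring S] [Algebra ℂ S] {gr : ZMod 2 → Submodule ℂ S} {ι : R →ₗ[ℂ] S}
  {E : Type} [Ring E] [Algebra ℂ E] {φ : S →ₐ[ℂ] E} {i : ZMod 2} {Δ Δ' : S →ₗ[ℂ] E}

theorem add (h : IsSDer gr φ i Δ) (h' : IsSDer gr φ i Δ') : IsSDer gr φ i (Δ + Δ') := by
  intro j b hb c
  simp only [LinearMap.add_apply, h j b hb, h' j b hb, add_mul, mul_add]
  module

theorem smul (k : ℂ) (h : IsSDer gr φ i Δ) : IsSDer gr φ i (k • Δ) := by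
  intro j b hb c
  simp only [LinearMap.smul_apply, h j b hb, smul_mul_assoc, mul_smul_comm]
  module

theorem sub (h : IsSDer gr φ i Δ) (h' : IsSDer gr φ i Δ') : IsSDer gr φ i (Δ - Δ') := by
  intro j b hb c
  simp only [LinearMap.sub_apply, h j b hb, h' j b hb, sub_mul, mul_sub]
  module

/-- The supercommutator of two superderivations is a superderivation. -/
theorem supercomm {p i : ZMod 2} {D D' : S →ₗ[ℂ] S} (hD : IsSDer gr (AlgHom.id ℂ S) p D)
    (hD' : IsSDer gr (AlgHom.id ℂ S) i D') (hDm : ∀ j, ∀ b ∈ gr j, D b ∈ gr (p + j))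
    (hDm' : ∀ j, ∀ b ∈ gr j, D' b ∈ gr (i + j)) :
    IsSDer gr (AlgHom.id ℂ S) (p + i) (D ∘ₗ D' - sg p i • (D' ∘ₗ D)) := by
  intro j b hb c
  simp only [LinearMap.sub_apply, LinearMap.comp_apply, LinearMap.smul_apply, hD' j b hb,
    hD j b hb, map_add, map_smul, AlgHom.id_apply, hD _ _ (hDm' j b hb), hD' _ _ (hDm j b hb),
    sg_add_left, sg_add_right, sub_mul, mul_sub, smul_mul_assoc, mul_smul_comm, sg_comm i p]
  rcases sg_eq_or p i with h1 | h1 <;> rcases sg_eq_or p j with h2 | h2 <;>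
    rcases sg_eq_or i j with h3 | h3 <;> simp only [h1, h2, h3] <;> module

theorem map_one (H : IsFreeSuper part gr ι) (h : IsSDer gr φ i Δ) : Δ 1 = 0 := by
  simpa using h 0 1 H.one_mem 1

/-- An even derivation satisfies the unsigned Leibniz rule. -/
theorem even_mul (H : IsFreeSuper part gr ι) {Δ : S →ₗ[ℂ] S}
    (h : IsSDer gr (AlgHom.id ℂ S) 0 Δ) (a b : S) : Δ (a * b) = Δ a * b + a * Δ b := by
  refine mem_of_parts H.compl (Q := LinearMap.eqLocus (Δ ∘ₗ LinearMap.mulRight ℂ b)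
    (LinearMap.mulRight ℂ b ∘ₗ Δ + LinearMap.mulRight ℂ (Δ b))) (fun i a ha => ?_) a
  have h := h i a ha b
  rw [sg_zero_left, one_smul] at h
  exact h

/-- A superderivation vanishing on generators is zero. -/
theorem eq_zero (H : IsFreeSuper part gr ι) (h : IsSDer gr φ i Δ) (h0 : ∀ r, Δ (ι r) = 0) :
    Δ = 0 := by
  ext x
  refine H.induct (LinearMap.ker Δ) (h.map_one H) (fun j r hr x hx => ?_) x
  rw [LinearMap.mem_ker] at hx ⊢
  rw [h j _ (H.ι_mem j r hr), h0, hx]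
  simp

theorem ext (H : IsFreeSuper part gr ι) (h : IsSDer gr φ i Δ) (h' : IsSDer gr φ i Δ')
    (h0 : ∀ r, Δ (ι r) = Δ' (ι r)) : Δ = Δ' := by
  rw [← sub_eq_zero]
  exact (h.sub h').eq_zero H fun r => by simp [h0]

/-- The parity of a superderivation is determined on generators. -/
theorem map_mem (H : IsFreeSuper part gr ι) (h : IsSDer gr φ i Δ) {pE : ZMod 2 → Submodule ℂ E}
    (hr : ∀ j k, ∀ e ∈ pE j, ∀ x ∈ gr k, e * φ x ∈ pE (j + k))
    (hl : ∀ j k, ∀ x ∈ gr j, ∀ e ∈ pE k, φ x * e ∈ pE (j + k))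
    (hι : ∀ j, ∀ r ∈ part j, Δ (ι r) ∈ pE (i + j)) (j : ZMod 2) (x : S) (hx : x ∈ gr j) :
    Δ x ∈ pE (i + j) := by
  refine H.homog_induct (fun j => (pE (i + j)).comap Δ) ?_ ?_ j x hx
  · rw [Submodule.mem_comap, h.map_one H]
    exact Submodule.zero_mem _
  · intro k j r hr' x hx hx'
    rw [Submodule.mem_comap] at hx' ⊢
    rw [h k _ (H.ι_mem k r hr')]
    refine Submodule.add_mem _ ?_ (Submodule.smul_mem _ _ ?_)
    · rw [← add_assoc]
      exact hr _ _ _ (hι k r hr') _ hx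
    · rw [add_left_comm]
      exact hl _ _ _ (H.ι_mem k r hr') _ hx'

/-- Superderivations of the free supercommutative superalgebra may be prescribed on
generators. -/
theorem exists_of_gen (H : IsFreeSuper part gr ι) (hp : IsCompl (part 0) (part 1))
    (φ : S →ₐ[ℂ] E) (i : ZMod 2) (f : R →ₗ[ℂ] E)
    (hf : ∀ j k, ∀ r ∈ part j, ∀ s ∈ part k,
      f r * φ (ι s) = sg (i + j) k • (φ (ι s) * f r)) :
    ∃ Δ : S →ₗ[ℂ] E, IsSDer gr φ i Δ ∧ ∀ r, Δ (ι r) = f r := by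
  obtain ⟨τ, hτ⟩ := exists_parity_twist hp i
  let M : R →ₗ[ℂ] Matrix (Fin 2) (Fin 2) E :=
    { toFun := fun r => !![φ (ι r), 0; f r, φ (ι (τ r))]
      map_add' := fun r s => by simp
      map_smul' := fun c r => by simp }
  have hM : ∀ r, M r = !![φ (ι r), 0; f r, φ (ι (τ r))] := fun r => rfl
  obtain ⟨Φ, hΦ⟩ := H.lift (Matrix (Fin 2) (Fin 2) E) M (by
    intro j k a ha b hb
    have hab : φ (ι a) * φ (ι b) = sg j k • (φ (ι b) * φ (ι a)) := by
      rw [← map_mul φ, ← map_mul φ, ← map_smul φ, H.scomm j k _ (H.ι_mem j a ha) _ (H.ι_mem k b hb)]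
    have h1 := hf j k a ha b hb
    have h2 := hf k j b hb a ha
    rw [hM, hM, hτ j a ha, hτ k b hb]
    simp only [map_smul, Matrix.mul_fin_two, Matrix.smul_of, Matrix.smul_cons, Matrix.smul_empty,
      mul_zero, zero_mul, add_zero, zero_add, smul_zero, smul_mul_assoc, mul_smul_comm, h1, h2, hab,
      sg_add_left, sg_comm k j, smul_add, smul_smul]
    rcases sg_eq_or i j with h3 | h3 <;> rcases sg_eq_or i k with h4 | h4 <;>
      rcases sg_eq_or j k with h5 | h5 <;> simp [h3, h4, h5, add_comm])
  have key : ∀ j, ∀ x ∈ gr j, Φ x 0 0 = φ x ∧ Φ x 0 1 = 0 ∧ Φ x 1 1 = sg i j • φ x := by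
    intro j x hx
    let ev : Fin 2 → Fin 2 → S →ₗ[ℂ] E := fun a b =>
      { toFun := fun x => Φ x a b
        map_add' := fun x y => by simp
        map_smul' := fun c x => by simp }
    have := H.homog_induct (fun j => LinearMap.eqLocus (ev 0 0) φ.toLinearMap ⊓
      (LinearMap.ker (ev 0 1) ⊓ LinearMap.eqLocus (ev 1 1) (sg i j • φ.toLinearMap)))
      (by simp [ev]) (by
        rintro k j r hr x - ⟨h1, h2, h3⟩
        have h1' : Φ x 0 0 = φ x := h1
        have h2' : Φ x 0 1 = 0 := h2
        have h3' : Φ x 1 1 = sg i j • φ x := h3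
        refine ⟨?_, ?_, ?_⟩
        · change Φ (ι r * x) 0 0 = φ (ι r * x)
          simp [Matrix.mul_apply, hΦ, hM, h1']
        · change Φ (ι r * x) 0 1 = 0
          simp [Matrix.mul_apply, hΦ, hM, h2']
        · change Φ (ι r * x) 1 1 = sg i (k + j) • φ (ι r * x)
          simp [Matrix.mul_apply, hΦ, hM, h2', h3', hτ k r hr, sg_add_right, smul_smul,
            mul_comm]) j x hx
    exact ⟨this.1, this.2.1, this.2.2⟩
  have hΦ0 : ∀ x, Φ x 0 0 = φ x := fun x => by
    refine mem_of_parts H.compl (Q := LinearMap.eqLocus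
      ({ toFun := fun x => Φ x 0 0
         map_add' := fun x y => by simp
         map_smul' := fun c x => by simp } : S →ₗ[ℂ] E) φ.toLinearMap) (fun j y hy => ?_) x
    exact (key j y hy).1
  refine ⟨{ toFun := fun x => Φ x 1 0
            map_add' := fun x y => by simp
            map_smul' := fun c x => by simp }, ?_, fun r => by simp [hΦ, hM]⟩
  intro j b hb c
  simp [Matrix.mul_apply, (key j b hb).2.2, hΦ0]

/-- Families of superderivations, depending linearly on a vector of a superspace, may be
prescribed on generators. -/
theorem exists_family_of_gen (H : IsFreeSuper part gr ι) (hp : IsCompl (part 0) (part 1))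
    {V : Type} [AddCommGroup V] [Module ℂ V] {vp : ZMod 2 → Submodule ℂ V}
    (hv : IsCompl (vp 0) (vp 1)) (φ : S →ₐ[ℂ] E) (F : V →ₗ[ℂ] R →ₗ[ℂ] E)
    (hF : ∀ i, ∀ v ∈ vp i, ∀ j k, ∀ r ∈ part j, ∀ s ∈ part k,
      F v r * φ (ι s) = sg (i + j) k • (φ (ι s) * F v r)) :
    ∃ G : V →ₗ[ℂ] S →ₗ[ℂ] E, (∀ i, ∀ v ∈ vp i, IsSDer gr φ i (G v)) ∧
      ∀ v r, G v (ι r) = F v r := by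
  have hex : ∀ i (v : vp i), ∃ Δ : S →ₗ[ℂ] E, IsSDer gr φ i Δ ∧ ∀ r, Δ (ι r) = F v r :=
    fun i v => exists_of_gen H hp φ i (F v) (hF i v v.2)
  choose g hg hgι using hex
  let g' : ∀ i, vp i →ₗ[ℂ] (S →ₗ[ℂ] E) := fun i =>
    { toFun := g i
      map_add' := fun v w => (hg i _).ext H ((hg i v).add (hg i w)) fun r => by simp [hgι]
      map_smul' := fun c v => (hg i _).ext H ((hg i v).smul c) fun r => by simp [hgι] }
  obtain ⟨G, hG⟩ := exists_linearMap_of_parts hv g'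
  refine ⟨G, fun i v hvi => ?_, fun v r => ?_⟩
  · rw [hG i v hvi]
    exact hg i ⟨v, hvi⟩
  · refine mem_of_parts hv (Q := LinearMap.eqLocus (G.flip (ι r)) (F.flip r)) (fun i v hvi => ?_) v
    rw [LinearMap.mem_eqLocus, LinearMap.flip_apply, LinearMap.flip_apply, hG i v hvi]
    exact hgι i ⟨v, hvi⟩ r

end IsSDer

/-- Exchanging the arguments of a bilinear map with the sign `(-1)^{ij}`. -/
theorem exists_super_flip {V W Z : Type*} [AddCommGroup V] [Module ℂ V] [AddCommGroup W]
    [Module ℂ W] [AddCommGroup Z] [Module ℂ Z] {vp : ZMod 2 → Submodule ℂ V}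
    {wp : ZMod 2 → Submodule ℂ W} (hv : IsCompl (vp 0) (vp 1)) (hw : IsCompl (wp 0) (wp 1))
    (M : V →ₗ[ℂ] W →ₗ[ℂ] Z) : ∃ M' : W →ₗ[ℂ] V →ₗ[ℂ] Z,
      ∀ i j, ∀ w ∈ wp i, ∀ v ∈ vp j, M' w v = sg i j • M v w := by
  choose τ hτ using fun i => exists_parity_twist hv i
  obtain ⟨M', hM'⟩ := exists_linearMap_of_parts hw
    (fun i => (M ∘ₗ τ i).flip ∘ₗ (wp i).subtype)
  refine ⟨M', fun i j w hw' v hv' => ?_⟩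
  rw [hM' i w hw']
  simp [hτ i j v hv']

theorem poly_induction {S : Type} [Ring S] {Q : S[X] → Prop} (hC : ∀ a, Q (C a))
    (hadd : ∀ f g, Q f → Q g → Q (f + g)) (hX : ∀ f, Q f → Q (X * f)) (f : S[X]) : Q f := by
  induction f using Polynomial.induction_on' with
  | add f g hf hg => exact hadd f g hf hg
  | monomial n a =>
    induction n with
    | zero => exact hC a
    | succ n ih =>
      rw [← X_mul_monomial]
      exact hX _ ih

section PolynomialOperators

variable {S : Type} [Ring S] [Algebra ℂ S] {M N : Type} [AddCommGroup M] [Module ℂ M]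
  [AddCommGroup N] [Module ℂ N]

/-- The constant polynomials, as an algebra homomorphism over `ℂ`. -/
def constHom (S : Type) [Ring S] [Algebra ℂ S] : S →ₐ[ℂ] S[X] := CAlgHom

@[simp]
theorem constHom_apply (a : S) : constHom S a = C a := rfl

/-- Multiplication by the variable. -/
def mulX (S : Type) [Ring S] [Algebra ℂ S] : Module.End ℂ S[X] := LinearMap.mulLeft ℂ X

@[simp]
theorem mulX_apply (f : S[X]) : mulX S f = X * f := rfl

/-- Substitution of the operator `P` for the variable: `∑ aₙ Xⁿ ↦ ∑ Pⁿ (j aₙ)`. -/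
def polyAct (P : Module.End ℂ M) (j : S →ₗ[ℂ] M) : S[X] →ₗ[ℂ] M :=
  Polynomial.lsum fun n => (P ^ n) ∘ₗ j

theorem polyAct_apply (P : Module.End ℂ M) (j : S →ₗ[ℂ] M) (f : S[X]) :
    polyAct P j f = f.sum fun n a => (P ^ n) (j a) := rfl

@[simp]
theorem polyAct_C (P : Module.End ℂ M) (j : S →ₗ[ℂ] M) (a : S) : polyAct P j (C a) = j a := by
  simp [polyAct_apply]

@[simp]
theorem polyAct_X_mul (P : Module.End ℂ M) (j : S →ₗ[ℂ] M) (f : S[X]) :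
    polyAct P j (X * f) = P (polyAct P j f) := by
  induction f using Polynomial.induction_on' with
  | add f g hf hg => simp [mul_add, hf, hg]
  | monomial n a => simp [X_mul_monomial, polyAct_apply, sum_monomial_index, pow_succ']

/-- A linear map intertwining two operators intertwines the substitutions. -/
theorem map_polyAct {P : Module.End ℂ M} {P' : Module.End ℂ N} {j : S →ₗ[ℂ] M} {j' : S →ₗ[ℂ] N}
    (K : M →ₗ[ℂ] N) (hK : ∀ x, K (P x) = P' (K x)) (hj : ∀ a, K (j a) = j' a) (f : S[X]) :
    K (polyAct P j f) = polyAct P' j' f := by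
  induction f using poly_induction with
  | hC a => simp [hj]
  | hadd f g hf hg => simp [hf, hg]
  | hX f hf => simp [hK, hf]

theorem polyAct_mem {P : Module.End ℂ M} {j : S →ₗ[ℂ] M} {Q : Submodule ℂ S} {Q' : Submodule ℂ M}
    (hP : ∀ x ∈ Q', P x ∈ Q') (hj : ∀ a ∈ Q, j a ∈ Q') (f : S[X]) (hf : ∀ n, f.coeff n ∈ Q) :
    polyAct P j f ∈ Q' := by
  rw [polyAct_apply, sum_def]
  refine Submodule.sum_mem _ fun n _ => ?_
  have h : ∀ n, ∀ x ∈ Q', (P ^ n) x ∈ Q' := by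
    intro n
    induction n with
    | zero => simp
    | succ n ih =>
      intro x hx
      rw [pow_succ']
      exact hP _ (ih x hx)
  exact h n _ (hj _ (hf n))

/-- Evaluation at a complex number. -/
def pEv (l : ℂ) : S[X] →ₗ[ℂ] S := polyAct (l • LinearMap.id) LinearMap.id

/-- Substitution of `-l-∂` for the variable. -/
def pSk (der : S →ₗ[ℂ] S) (l : ℂ) : S[X] →ₗ[ℂ] S :=
  polyAct (-(l • LinearMap.id) - der) LinearMap.id

/-- The coefficientwise application of a linear map, with values in polynomials, followed by
summation. -/
def pExt (j : S →ₗ[ℂ] S[X]) : S[X] →ₗ[ℂ] S[X] := polyAct (mulX S) j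

/-- The coefficientwise application of a linear map. -/
def pMap (D : S →ₗ[ℂ] S) : S[X] →ₗ[ℂ] S[X] := pExt ((constHom S).toLinearMap ∘ₗ D)

/-- Substitution of `-X-∂` for the variable. -/
def pT (der : S →ₗ[ℂ] S) : S[X] →ₗ[ℂ] S[X] :=
  polyAct (-mulX S - pMap der) (constHom S).toLinearMap

/-- Translation of the variable. -/
def pTau (l : ℂ) : S[X] →ₗ[ℂ] S[X] :=
  polyAct (mulX S + l • LinearMap.id) (constHom S).toLinearMap

/-- The right product `∑ aₙ Xⁿ ▷ c = ∑ aₙ (X+∂)ⁿ c`. -/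
def pTri (der : S →ₗ[ℂ] S) : S[X] →ₗ[ℂ] (S →ₗ[ℂ] S[X]) :=
  polyAct (LinearMap.llcomp ℂ S S[X] S[X] (mulX S) + (LinearMap.lcomp ℂ S[X] der))
    ((LinearMap.llcomp ℂ S S S[X] (constHom S).toLinearMap) ∘ₗ LinearMap.mul ℂ S)

variable (der : S →ₗ[ℂ] S) (l : ℂ)

@[simp] theorem pEv_C (a : S) : pEv l (C a) = a := by simp [pEv]
@[simp] theorem pEv_X_mul (f : S[X]) : pEv l (X * f) = l • pEv l f := by simp [pEv]
@[simp] theorem pSk_C (a : S) : pSk der l (C a) = a := by simp [pSk]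
@[simp] theorem pSk_X_mul (f : S[X]) :
    pSk der l (X * f) = -(l • pSk der l f) - der (pSk der l f) := by simp [pSk]
@[simp] theorem pExt_C (j : S →ₗ[ℂ] S[X]) (a : S) : pExt j (C a) = j a := by simp [pExt]
@[simp] theorem pExt_X_mul (j : S →ₗ[ℂ] S[X]) (f : S[X]) : pExt j (X * f) = X * pExt j f := by
  simp [pExt]
@[simp] theorem pMap_C (D : S →ₗ[ℂ] S) (a : S) : pMap D (C a) = C (D a) := by simp [pMap]
@[simp] theorem pMap_X_mul (D : S →ₗ[ℂ] S) (f : S[X]) : pMap D (X * f) = X * pMap D f := by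
  simp [pMap]
@[simp] theorem pT_C (a : S) : pT der (C a) = C a := by simp [pT]
@[simp] theorem pT_X_mul (f : S[X]) :
    pT der (X * f) = -(X * pT der f) - pMap der (pT der f) := by simp [pT]
@[simp] theorem pTau_C (a : S) : pTau l (C a) = C a := by simp [pTau]
@[simp] theorem pTau_X_mul (f : S[X]) : pTau l (X * f) = X * pTau l f + l • pTau l f := by
  simp [pTau]
@[simp] theorem pTri_C (a c : S) : pTri der (C a) c = C (a * c) := by simp [pTri]
@[simp] theorem pTri_X_mul (f : S[X]) (c : S) :
    pTri der (X * f) c = X * pTri der f c + pTri der f (der c) := by simp [pTri]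

theorem coeff_pExt (j : S →ₗ[ℂ] S[X]) (f : S[X]) (m : ℕ) :
    (pExt j f).coeff m = ∑ k ∈ Finset.range (m + 1), (j (f.coeff k)).coeff (m - k) := by
  induction f using poly_induction generalizing m with
  | hC a =>
    rw [pExt_C, Finset.sum_eq_single 0]
    · simp
    · intro k _ hk
      simp [coeff_C, hk]
    · simp
  | hadd f g hf hg => simp [hf, hg, Finset.sum_add_distrib]
  | hX f hf =>
    rw [pExt_X_mul, Finset.sum_range_succ']
    cases m with
    | zero => simp
    | succ m => simp [coeff_X_mul, hf]

theorem coeff_pMap (D : S →ₗ[ℂ] S) (f : S[X]) (m : ℕ) : (pMap D f).coeff m = D (f.coeff m) := by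
  rw [pMap, coeff_pExt, Finset.sum_eq_single m]
  · simp
  · intro k hk hkm
    have : m - k ≠ 0 := by
      rw [Finset.mem_range] at hk
      omega
    simp [coeff_C, this]
  · simp

theorem pEv_eq_eval (f : S[X]) : pEv l f = f.eval (algebraMap ℂ S l) := by
  induction f using poly_induction with
  | hC a => simp
  | hadd f g hf hg => simp [hf, hg]
  | hX f hf =>
    rw [pEv_X_mul, hf, X_mul, eval_mul_X, Algebra.smul_def, Algebra.commutes]

theorem pTau_eq_taylor (f : S[X]) : pTau l f = taylor (algebraMap ℂ S l) f := by
  induction f using poly_induction with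
  | hC a => simp
  | hadd f g hf hg => simp [hf, hg]
  | hX f hf =>
    rw [pTau_X_mul, hf, X_mul, X_mul, taylor_apply, taylor_apply, mul_X_comp, mul_add]
    congr 1
    rw [Algebra.smul_def]
    exact (Algebra.commutes l (taylor (algebraMap ℂ S l) f) :)

theorem coeff_pTau (f : S[X]) (n : ℕ) : (pTau l f).coeff n = pEv l (hasseDeriv n f) := by
  rw [pTau_eq_taylor, taylor_coeff, pEv_eq_eval]

theorem pEv_pTau (g : ℂ) (f : S[X]) : pEv g (pTau l f) = pEv (l + g) f := by
  rw [pTau]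
  refine map_polyAct (M := S[X]) (N := S) (pEv g) (fun x => ?_) (fun a => ?_) f
  · simp [add_smul, add_comm]
  · simp

theorem pSk_pTau (g : ℂ) (f : S[X]) : pSk der (g + l) (pTau l f) = pSk der g f := by
  rw [pTau]
  refine map_polyAct (M := S[X]) (N := S) (pSk der (g + l)) (fun x => ?_) (fun a => ?_) f
  · simp only [LinearMap.add_apply, mulX_apply, LinearMap.smul_apply, LinearMap.id_apply, map_add,
      pSk_X_mul, map_smul, LinearMap.sub_apply, LinearMap.neg_apply]
    module
  · simp

theorem pEv_pMap (D : S →ₗ[ℂ] S) (f : S[X]) : pEv l (pMap D f) = D (pEv l f) := by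
  induction f using poly_induction with
  | hC a => simp
  | hadd f g hf hg => simp [hf, hg]
  | hX f hf => simp [hf]

theorem pEv_pT (f : S[X]) : pEv l (pT der f) = pSk der l f := by
  rw [pT]
  refine map_polyAct (M := S[X]) (N := S) (pEv l) (fun x => ?_) (fun a => ?_) f
  · simp [pEv_pMap]
  · simp

theorem map_pSk {D : S →ₗ[ℂ] S} (h : ∀ x, D (der x) = der (D x)) (f : S[X]) :
    D (pSk der l f) = pSk der l (pMap D f) := by
  induction f using poly_induction with
  | hC a => simp
  | hadd f g hf hg => simp [hf, hg]
  | hX f hf => simp [hf, h]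

theorem pMap_pT (f : S[X]) : pT der (pMap der f) = pMap der (pT der f) := by
  induction f using poly_induction with
  | hC a => simp
  | hadd f g hf hg => simp [hf, hg]
  | hX f hf => simp [hf]

@[simp]
theorem pT_pT (f : S[X]) : pT der (pT der f) = f := by
  induction f using poly_induction with
  | hC a => simp
  | hadd f g hf hg => simp [hf, hg]
  | hX f hf => simp [hf, pMap_pT]

theorem pMap_mul_C (hd : ∀ a b, der (a * b) = der a * b + a * der b) (f : S[X]) (c : S) :
    pMap der (f * C c) = pMap der f * C c + f * C (der c) := by
  ext n
  simp [coeff_pMap, hd]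

theorem pT_pTri (hd : ∀ a b, der (a * b) = der a * b + a * der b) (f : S[X]) (c : S) :
    pT der (pTri der f c) = pT der f * C c := by
  induction f using poly_induction generalizing c with
  | hC a => rw [pTri_C, pT_C, pT_C, C_mul]
  | hadd f g hf hg => simp [hf, hg, add_mul]
  | hX f hf =>
    simp only [pTri_X_mul, map_add, pT_X_mul, hf, pMap_mul_C der hd, sub_mul, neg_mul, mul_assoc]
    abel

theorem pT_mul_C (hd : ∀ a b, der (a * b) = der a * b + a * der b) (f : S[X]) (c : S) :
    pT der (f * C c) = pTri der (pT der f) c := by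
  rw [← pT_pT der (pTri der (pT der f) c), pT_pTri der hd, pT_pT]

theorem pTri_C_mul (f : S[X]) (y c : S) : pTri der (C y * f) c = C y * pTri der f c := by
  induction f using poly_induction generalizing c with
  | hC a => rw [← C_mul, pTri_C, pTri_C, mul_assoc, C_mul]
  | hadd f g hf hg => simp [hf, hg, mul_add]
  | hX f hf =>
    have h : ∀ g : S[X], C y * (X * g) = X * (C y * g) := fun g => by
      rw [← mul_assoc, ← X_mul_C, mul_assoc]
    rw [h, pTri_X_mul, pTri_X_mul, hf, hf, mul_add, h]

/-- A polynomial vanishing at all complex numbers is zero. -/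
theorem poly_eq_zero_of_pEv {f : S[X]} (h : ∀ l, pEv l f = 0) : f = 0 := by
  ext n
  rw [coeff_zero, ← Module.forall_dual_apply_eq_zero_iff ℂ]
  intro φ
  let j : S →ₗ[ℂ] ℂ[X] := (CAlgHom (R := ℂ) (A := ℂ)).toLinearMap ∘ₗ φ
  have hj : ∀ a, j a = C (φ a) := fun a => rfl
  let p : S[X] →ₗ[ℂ] ℂ[X] := polyAct (LinearMap.mulLeft ℂ X) j
  have hp : ∀ f n, (p f).coeff n = φ (f.coeff n) := by
    intro f
    induction f using poly_induction with
    | hC a =>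
      intro n
      simp only [p, polyAct_C, hj, coeff_C]
      split_ifs <;> simp
    | hadd f g hf hg => simp [hf, hg]
    | hX f hf =>
      intro n
      cases n with
      | zero => simp [p]
      | succ n => simpa [p, coeff_X_mul] using hf n
  have hev : ∀ l f, (p f).eval l = φ (pEv l f) := by
    intro l f
    induction f using poly_induction with
    | hC a => simp [p, hj]
    | hadd f g hf hg => simp [hf, hg]
    | hX f hf =>
      simp only [p, polyAct_X_mul, LinearMap.mulLeft_apply, eval_mul, eval_X, pEv_X_mul, map_smul,
        smul_eq_mul] at hf ⊢
      rw [hf]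
  have h0 : p f = 0 := Polynomial.funext fun l => by simp [hev, h]
  rw [← hp, h0, coeff_zero]

theorem poly_ext_pEv {f g : S[X]} (h : ∀ l, pEv l f = pEv l g) : f = g := by
  rw [← sub_eq_zero]
  exact poly_eq_zero_of_pEv fun l => by simp [h]

theorem coeff_pT_C_mul_X_pow (a : S) (m n : ℕ) :
    (pT der (X ^ m * C a)).coeff n = ((-1 : ℂ) ^ m * (m.choose n : ℂ)) • (der ^ (m - n)) a := by
  induction m generalizing n with
  | zero =>
    cases n with
    | zero => simp
    | succ n => simp
  | succ m ih =>
    rw [pow_succ', mul_assoc, pT_X_mul, coeff_sub, coeff_neg, coeff_pMap, ih]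
    cases n with
    | zero =>
      simp only [mul_coeff_zero, coeff_X_zero, zero_mul, neg_zero, zero_sub, map_smul,
        Nat.choose_zero_right, Nat.cast_one, mul_one, Nat.sub_zero, pow_succ', Module.End.mul_apply]
      module
    | succ n =>
      rw [coeff_X_mul, ih, Nat.succ_sub_succ, Nat.choose_succ_succ]
      rcases le_or_gt (n + 1) m with h | h
      · have h1 : m - n = (m - (n + 1)) + 1 := by omega
        rw [h1, map_smul, pow_succ' der, Module.End.mul_apply, Nat.cast_add, pow_succ']
        module
      · rw [Nat.choose_eq_zero_of_lt h, pow_succ' (-1 : ℂ)]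
        simp only [Nat.cast_zero, mul_zero, zero_smul, map_zero, sub_zero, add_zero]
        module

/-- The coefficients of `f(-X-∂)`. -/
theorem coeff_pT (f : S[X]) (n K : ℕ) (hK : ∀ m, n + K ≤ m → f.coeff m = 0) :
    (pT der f).coeff n = ∑ k ∈ Finset.range K,
      ((-1 : ℂ) ^ (n + k) * ((n + k).choose n : ℂ)) • (der ^ k) (f.coeff (n + k)) := by
  have hf : f = ∑ m ∈ Finset.range (n + K), X ^ m * C (f.coeff m) := by
    ext m
    simp only [finsetSum_coeff, X_pow_mul, coeff_C_mul, coeff_X_pow, mul_ite, mul_one, mul_zero]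
    rw [Finset.sum_ite_eq]
    split_ifs with h
    · rfl
    · exact hK m (by simpa using h)
  conv_lhs => rw [hf]
  rw [map_sum, finsetSum_coeff]
  simp only [coeff_pT_C_mul_X_pow]
  rw [Finset.sum_range_add, Finset.sum_eq_zero, zero_add]
  · simp
  · intro m hm
    rw [Nat.choose_eq_zero_of_lt (Finset.mem_range.1 hm)]
    simp

end PolynomialOperators

section PolyGr

variable {R : Type} [AddCommGroup R] [Module ℂ R] {part : ZMod 2 → Submodule ℂ R}
  {S : Type} [Ring S] [Algebra ℂ S] {gr : ZMod 2 → Submodule ℂ S} {ι : R →ₗ[ℂ] S}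

/-- The polynomials with coefficients of parity `k`. -/
def polyGr (gr : ZMod 2 → Submodule ℂ S) (k : ZMod 2) : Submodule ℂ S[X] where
  carrier := {f | ∀ n, f.coeff n ∈ gr k}
  zero_mem' := fun n => by simp
  add_mem' := fun hf hg n => by simpa using Submodule.add_mem _ (hf n) (hg n)
  smul_mem' := fun c f hf n => by simpa using Submodule.smul_mem _ c (hf n)

theorem C_mem_polyGr {k : ZMod 2} {a : S} (ha : a ∈ gr k) : C a ∈ polyGr gr k := by
  intro n
  rw [coeff_C]
  split_ifs
  · exact ha
  · exact Submodule.zero_mem _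

theorem X_mul_mem_polyGr {k : ZMod 2} {f : S[X]} (hf : f ∈ polyGr gr k) :
    X * f ∈ polyGr gr k := by
  rintro (_ | n)
  · simp
  · simpa [coeff_X_mul] using hf n

theorem pEv_mem {k : ZMod 2} {f : S[X]} (hf : f ∈ polyGr gr k) (l : ℂ) : pEv l f ∈ gr k :=
  polyAct_mem (fun x hx => by simpa using Submodule.smul_mem _ l hx) (fun a ha => by simpa using ha)
    f hf

theorem pMap_mem {j k : ZMod 2} {D : S →ₗ[ℂ] S} (hD : ∀ a ∈ gr j, D a ∈ gr k) {f : S[X]}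
    (hf : f ∈ polyGr gr j) : pMap D f ∈ polyGr gr k := by
  intro n
  rw [coeff_pMap]
  exact hD _ (hf n)

theorem pT_mem {k : ZMod 2} {der : S →ₗ[ℂ] S} (hd : ∀ a ∈ gr k, der a ∈ gr k) {f : S[X]}
    (hf : f ∈ polyGr gr k) : pT der f ∈ polyGr gr k := by
  refine polyAct_mem (fun x hx => ?_) (fun a ha => C_mem_polyGr ha) f hf
  exact Submodule.sub_mem _ (Submodule.neg_mem _ (X_mul_mem_polyGr hx)) (pMap_mem hd hx)

theorem pEv_mul_C (l : ℂ) (f : S[X]) (c : S) : pEv l (f * C c) = pEv l f * c := by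
  induction f using poly_induction with
  | hC a => rw [← C_mul, pEv_C, pEv_C]
  | hadd f g hf hg => simp [add_mul, hf, hg]
  | hX f hf => simp [mul_assoc, hf]

theorem pEv_C_mul (l : ℂ) (f : S[X]) (c : S) : pEv l (C c * f) = c * pEv l f := by
  induction f using poly_induction with
  | hC a => rw [← C_mul, pEv_C, pEv_C]
  | hadd f g hf hg => simp [mul_add, hf, hg]
  | hX f hf => rw [← mul_assoc, ← X_mul_C, mul_assoc, pEv_X_mul, hf, pEv_X_mul, mul_smul_comm]

namespace IsFreeSuper

theorem polyGr_mul_C (H : IsFreeSuper part gr ι) {j k : ZMod 2} {f : S[X]} (hf : f ∈ polyGr gr j)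
    {x : S} (hx : x ∈ gr k) : f * C x ∈ polyGr gr (j + k) := fun n => by
  rw [coeff_mul_C]
  exact H.mul_mem _ _ _ (hf n) _ hx

theorem polyGr_C_mul (H : IsFreeSuper part gr ι) {j k : ZMod 2} {x : S} (hx : x ∈ gr j)
    {f : S[X]} (hf : f ∈ polyGr gr k) : C x * f ∈ polyGr gr (j + k) := fun n => by
  rw [coeff_C_mul]
  exact H.mul_mem _ _ _ hx _ (hf n)

theorem polyGr_scomm (H : IsFreeSuper part gr ι) {j k : ZMod 2} {f : S[X]} (hf : f ∈ polyGr gr j)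
    {x : S} (hx : x ∈ gr k) : f * C x = sg j k • (C x * f) := by
  ext n
  rw [coeff_mul_C, coeff_smul, coeff_C_mul]
  exact H.scomm _ _ _ (hf n) _ hx

end IsFreeSuper

/-- A `λ`-bracket `B` with values in polynomials on the free supercommutative superalgebra: the
left Leibniz rule holds, and skewsymmetry holds when the second argument is a generator. -/
structure IsSuperBracket (part : ZMod 2 → Submodule ℂ R) (gr : ZMod 2 → Submodule ℂ S)
    (ι : R →ₗ[ℂ] S) (dS : S →ₗ[ℂ] S) (B : S →ₗ[ℂ] S →ₗ[ℂ] S[X]) : Prop where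
  free : IsFreeSuper part gr ι
  compl : IsCompl (part 0) (part 1)
  der_sder : IsSDer gr (AlgHom.id ℂ S) 0 dS
  der_mem : ∀ i, ∀ a ∈ gr i, dS a ∈ gr i
  sder : ∀ i, ∀ a ∈ gr i, IsSDer gr (constHom S) i (B a)
  skew_gen : ∀ i j, ∀ a ∈ gr i, ∀ s ∈ part j, B a (ι s) = -sg i j • pT dS (B (ι s) a)
  mem : ∀ i j, ∀ a ∈ gr i, ∀ b ∈ gr j, B a b ∈ polyGr gr (i + j)

theorem IsSDer.map_mem_polyGr (H : IsFreeSuper part gr ι) {i : ZMod 2} {Δ : S →ₗ[ℂ] S[X]}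
    (h : IsSDer gr (constHom S) i Δ) (hι : ∀ j, ∀ r ∈ part j, Δ (ι r) ∈ polyGr gr (i + j))
    (j : ZMod 2) (x : S) (hx : x ∈ gr j) : Δ x ∈ polyGr gr (i + j) :=
  h.map_mem (pE := polyGr gr) H (fun _ _ _ he _ hx => H.polyGr_mul_C he hx)
    (fun _ _ _ hx _ he => H.polyGr_C_mul hx he)
    hι j x hx

/-- Superderivations of the free supercommutative superalgebra extending an operator on the
generators. -/
theorem IsFreeSuper.exists_sder (H : IsFreeSuper part gr ι) (hp : IsCompl (part 0) (part 1))
    (p : ZMod 2) (D : R →ₗ[ℂ] R) (hD : ∀ i, ∀ r ∈ part i, D r ∈ part (p + i)) :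
    ∃ dS : S →ₗ[ℂ] S, IsSDer gr (AlgHom.id ℂ S) p dS ∧ (∀ i, ∀ a ∈ gr i, dS a ∈ gr (p + i)) ∧
      ∀ r, dS (ι r) = ι (D r) := by
  obtain ⟨dS, h1, h2⟩ := IsSDer.exists_of_gen H hp (AlgHom.id ℂ S) p (ι ∘ₗ D)
    (fun j k r hr s hs => H.scomm _ _ _ (H.ι_mem _ _ (hD j r hr)) _ (H.ι_mem _ _ hs))
  refine ⟨dS, h1, h1.map_mem H (fun j k e he x hx => H.mul_mem _ _ _ he _ hx)
    (fun j k x hx e he => H.mul_mem _ _ _ hx _ he) (fun j r hr => ?_), h2⟩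
  rw [h2]
  exact H.ι_mem _ _ (hD j r hr)

/-- A skewsymmetric bracket on generators extends to the free supercommutative superalgebra. -/
theorem IsFreeSuper.exists_superBracket (H : IsFreeSuper part gr ι)
    (hp : IsCompl (part 0) (part 1)) (dS : S →ₗ[ℂ] S) (hd : IsSDer gr (AlgHom.id ℂ S) 0 dS)
    (hdm : ∀ i, ∀ a ∈ gr i, dS a ∈ gr i) (F : R →ₗ[ℂ] R →ₗ[ℂ] S[X])
    (hFm : ∀ i j, ∀ r ∈ part i, ∀ s ∈ part j, F r s ∈ polyGr gr (i + j))
    (hF : ∀ i j, ∀ r ∈ part i, ∀ s ∈ part j, F r s = -sg i j • pT dS (F s r)) :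
    ∃ B : S →ₗ[ℂ] S →ₗ[ℂ] S[X], IsSuperBracket part gr ι dS B ∧
      ∀ r s, B (ι r) (ι s) = F r s := by
  obtain ⟨L, hL, hLF⟩ := IsSDer.exists_family_of_gen H hp hp (constHom S) F
    (fun i v hv j k r hr s hs => H.polyGr_scomm (hFm i j v hv r hr) (H.ι_mem k s hs))
  have hLm : ∀ i j, ∀ r ∈ part i, ∀ b ∈ gr j, L r b ∈ polyGr gr (i + j) := fun i j r hr b hb =>
    (hL i r hr).map_mem_polyGr H (fun k s hs => by
      rw [hLF]
      exact hFm i k r hr s hs) j b hb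
  obtain ⟨F', hF'⟩ := exists_super_flip hp H.compl (L.compr₂ (-(pT dS)))
  have hF's : ∀ i j, ∀ a ∈ gr i, ∀ s ∈ part j, F' a s = -sg i j • pT dS (L s a) :=
    fun i j a ha s hs => by
      rw [hF' i j a ha s hs, LinearMap.compr₂_apply, LinearMap.neg_apply, smul_neg, neg_smul]
  have hF'm : ∀ i j, ∀ a ∈ gr i, ∀ s ∈ part j, F' a s ∈ polyGr gr (i + j) :=
    fun i j a ha s hs => by
      rw [hF's i j a ha s hs]
      refine Submodule.smul_mem _ _ (pT_mem (hdm _) ?_)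
      rw [add_comm]
      exact hLm j i s hs a ha
  obtain ⟨B, hB, hBF⟩ := IsSDer.exists_family_of_gen H hp H.compl (constHom S) F'
    (fun i v hv j k r hr s hs => H.polyGr_scomm (hF'm i j v hv r hr) (H.ι_mem k s hs))
  have hBL : ∀ i, ∀ r ∈ part i, B (ι r) = L r := fun i r hr => by
    refine (hB i _ (H.ι_mem i r hr)).ext H (hL i r hr) fun s => ?_
    refine mem_of_parts hp (Q := LinearMap.eqLocus (B (ι r) ∘ₗ ι) (L r ∘ₗ ι)) (fun j s hs => ?_) s
    rw [LinearMap.mem_eqLocus, LinearMap.comp_apply, LinearMap.comp_apply, hBF, hLF,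
      hF's i j _ (H.ι_mem i r hr) s hs, hLF, ← hF i j r hr s hs]
  refine ⟨B, ⟨H, hp, hd, hdm, hB, fun i j a ha s hs => ?_, fun i j a ha b hb => ?_⟩, fun r s => ?_⟩
  · rw [hBF, hF's i j a ha s hs, hBL j s hs]
  · refine (hB i a ha).map_mem_polyGr H (fun k s hs => ?_) j b hb
    rw [hBF]
    exact hF'm i k a ha s hs
  · rw [← hLF]
    exact LinearMap.congr_fun (mem_of_parts hp
      (Q := LinearMap.eqLocus (LinearMap.lcomp ℂ S[X] ι ∘ₗ B ∘ₗ ι) (LinearMap.lcomp ℂ S[X] ι ∘ₗ L))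
      (fun i r hr => by simp [hBL i r hr]) r) s

end PolyGr

namespace IsSuperBracket

variable {R : Type} [AddCommGroup R] [Module ℂ R] {part : ZMod 2 → Submodule ℂ R}
  {S : Type} [Ring S] [Algebra ℂ S] {gr : ZMod 2 → Submodule ℂ S} {ι : R →ₗ[ℂ] S}
  {dS : S →ₗ[ℂ] S} {B : S →ₗ[ℂ] S →ₗ[ℂ] S[X]}

theorem der_mul (hB : IsSuperBracket part gr ι dS B) (a b : S) :
    dS (a * b) = dS a * b + a * dS b :=
  IsSDer.even_mul hB.free hB.der_sder a b

theorem one_right (hB : IsSuperBracket part gr ι dS B) (a : S) : B a 1 = 0 :=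
  mem_of_parts hB.free.compl (Q := LinearMap.ker (B.flip 1))
    (fun i a ha => (hB.sder i a ha).map_one hB.free) a

theorem one_left (hB : IsSuperBracket part gr ι dS B) : B 1 = 0 := by
  refine (hB.sder 0 1 hB.free.one_mem).eq_zero hB.free fun r => ?_
  refine mem_of_parts hB.compl (Q := LinearMap.ker (B 1 ∘ₗ ι)) (fun i r hr => ?_) r
  rw [LinearMap.mem_ker, LinearMap.comp_apply, hB.skew_gen 0 i 1 hB.free.one_mem r hr,
    hB.one_right, map_zero, smul_zero]

theorem leibniz (hB : IsSuperBracket part gr ι dS B) {i j : ZMod 2} {a b : S} (ha : a ∈ gr i)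
    (hb : b ∈ gr j) (c : S) : B a (b * c) = B a b * C c + sg i j • (C b * B a c) :=
  hB.sder i a ha j b hb c

theorem pTri_mem (hB : IsSuperBracket part gr ι dS B) {i j : ZMod 2} {f : S[X]} {c : S}
    (hf : f ∈ polyGr gr i) (hc : c ∈ gr j) : pTri dS f c ∈ polyGr gr (i + j) := by
  rw [← pT_pT dS (pTri dS f c), pT_pTri dS hB.der_mul]
  exact pT_mem (hB.der_mem _) (hB.free.polyGr_mul_C (pT_mem (hB.der_mem _) hf) hc)

theorem pTri_mul_C (hB : IsSuperBracket part gr ι dS B) {i j k : ZMod 2} {f : S[X]} {c x : S}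
    (hf : f ∈ polyGr gr i) (hc : c ∈ gr j) (hx : x ∈ gr k) :
    pTri dS (f * C x) c = sg k j • (pTri dS f c * C x) := by
  rw [hB.free.polyGr_scomm hf hx, hB.free.polyGr_scomm (hB.pTri_mem hf hc) hx, map_smul,
    LinearMap.smul_apply, pTri_C_mul, smul_smul, sg_add_left, sg_comm k j, mul_comm (sg i k),
    ← mul_assoc, sg_mul_self, one_mul]

/-- The right Leibniz rule. -/
theorem right_leibniz (hB : IsSuperBracket part gr ι dS B) {i j k : ZMod 2} {a b c : S}
    (hb : b ∈ gr i) (hc : c ∈ gr j) (ha : a ∈ gr k) :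
    B (b * c) a = sg j k • pTri dS (B b a) c + sg i (j + k) • pTri dS (B c a) b := by
  have hbc := hB.free.mul_mem _ _ _ hb _ hc
  refine hB.free.homog_induct (fun k => LinearMap.eqLocus (B (b * c))
    (sg j k • ((pTri dS).flip c ∘ₗ B b) + sg i (j + k) • ((pTri dS).flip b ∘ₗ B c))) ?_ ?_ k a ha
  · simp [hB.one_right]
  · intro m k s hs x hx ih
    have ih' : B (b * c) x = sg j k • pTri dS (B b x) c + sg i (j + k) • pTri dS (B c x) b := ih
    change B (b * c) (ι s * x) = sg j (m + k) • pTri dS (B b (ι s * x)) c +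
      sg i (j + (m + k)) • pTri dS (B c (ι s * x)) b
    have hιs := hB.free.ι_mem m s hs
    have hbs := hB.mem i m b hb _ hιs
    have hcs := hB.mem j m c hc _ hιs
    have hCb : C b * B (ι s) c = sg (m + j) i • (B (ι s) c * C b) := by
      rw [hB.free.polyGr_scomm (hB.mem m j _ hιs c hc) hb, smul_smul, sg_mul_self, one_smul]
    have base : B (b * c) (ι s) =
        sg j m • pTri dS (B b (ι s)) c + sg i (j + m) • pTri dS (B c (ι s)) b := by
      rw [hB.skew_gen _ m _ hbc s hs, hB.skew_gen i m b hb s hs, hB.skew_gen j m c hc s hs,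
        hB.leibniz hιs hb, hCb]
      simp only [map_add, map_smul, pT_mul_C dS hB.der_mul, LinearMap.smul_apply, sg_add_left,
        sg_add_right, sg_comm m i, sg_comm j i]
      rcases sg_eq_or i j with h1 | h1 <;> rcases sg_eq_or i m with h2 | h2 <;>
        rcases sg_eq_or j m with h3 | h3 <;> simp only [h1, h2, h3] <;> module
    rw [hB.leibniz hbc hιs, hB.leibniz hb hιs, hB.leibniz hc hιs, ih', base]
    simp only [map_add, map_smul, LinearMap.add_apply, LinearMap.smul_apply, pTri_C_mul,
      hB.pTri_mul_C hbs hc hx, hB.pTri_mul_C hcs hb hx, add_mul, mul_add, smul_mul_assoc,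
      mul_smul_comm, sg_add_left, sg_add_right, sg_comm k j, sg_comm k i]
    rcases sg_eq_or i j with h1 | h1 <;> rcases sg_eq_or i m with h2 | h2 <;>
      rcases sg_eq_or j m with h3 | h3 <;> rcases sg_eq_or i k with h4 | h4 <;>
      rcases sg_eq_or j k with h5 | h5 <;> simp only [h1, h2, h3, h4, h5] <;> module

/-- Skewsymmetry. -/
theorem skew (hB : IsSuperBracket part gr ι dS B) {i j : ZMod 2} {a b : S} (ha : a ∈ gr i)
    (hb : b ∈ gr j) : B a b = -sg i j • pT dS (B b a) := by
  refine hB.free.homog_induct (fun j => LinearMap.eqLocus (B a)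
    (-sg i j • (pT dS ∘ₗ B.flip a))) ?_ ?_ j b hb
  · simp [hB.one_right, hB.one_left]
  · intro m k s hs x hx ih
    have ih' : B a x = -sg i k • pT dS (B x a) := ih
    change B a (ι s * x) = -sg i (m + k) • pT dS (B (ι s * x) a)
    have hιs := hB.free.ι_mem m s hs
    have h1 := hB.skew_gen i m a ha s hs
    have h2 : pT dS (B (ι s) a) = -sg i m • B a (ι s) := by
      rw [h1, smul_smul, neg_mul_neg, sg_mul_self, one_smul]
    have h3 : pT dS (B x a) = -sg i k • B a x := by
      rw [ih', smul_smul, neg_mul_neg, sg_mul_self, one_smul]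
    rw [hB.leibniz ha hιs, hB.right_leibniz hιs hx ha]
    simp only [map_add, map_smul, pT_pTri dS hB.der_mul, h2, h3, smul_mul_assoc,
      hB.free.polyGr_scomm (hB.mem i k a ha x hx) hιs, sg_add_left,
      sg_add_right, sg_comm m i, sg_comm k i, sg_comm k m]
    rcases sg_eq_or i m with h1 | h1 <;> rcases sg_eq_or i k with h2 | h2 <;>
      rcases sg_eq_or m k with h3 | h3 <;> simp only [h1, h2, h3] <;> module

theorem skew_pEv (hB : IsSuperBracket part gr ι dS B) {i j : ZMod 2} {a b : S} (ha : a ∈ gr i)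
    (hb : b ∈ gr j) (l : ℂ) : pEv l (B a b) = -sg i j • pSk dS l (B b a) := by
  rw [hB.skew ha hb, map_smul, pEv_pT]

theorem skew_pSk (hB : IsSuperBracket part gr ι dS B) {i j : ZMod 2} {a b : S} (ha : a ∈ gr i)
    (hb : b ∈ gr j) (l : ℂ) : pSk dS l (B b a) = -sg i j • pEv l (B a b) := by
  rw [hB.skew_pEv ha hb, smul_smul, neg_mul_neg, sg_mul_self, one_smul]

theorem sder_pEv (hB : IsSuperBracket part gr ι dS B) {i : ZMod 2} {a : S} (ha : a ∈ gr i)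
    (l : ℂ) : IsSDer gr (AlgHom.id ℂ S) i (pEv l ∘ₗ B a) := by
  intro j b hb c
  simp [hB.leibniz ha hb, pEv_mul_C, pEv_C_mul]

theorem pEv_mem (hB : IsSuperBracket part gr ι dS B) {i j : ZMod 2} {a b : S} (ha : a ∈ gr i)
    (hb : b ∈ gr j) (l : ℂ) : pEv l (B a b) ∈ gr (i + j) :=
  _root_.pEv_mem (hB.mem i j a ha b hb) l

/-- An identity between superderivations holding on homogeneous generators holds everywhere. -/
theorem eq_of_parts (hB : IsSuperBracket part gr ι dS B) {i : ZMod 2} {Δ Δ' : S →ₗ[ℂ] S}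
    (h : IsSDer gr (AlgHom.id ℂ S) i Δ) (h' : IsSDer gr (AlgHom.id ℂ S) i Δ')
    (h0 : ∀ j, ∀ r ∈ part j, Δ (ι r) = Δ' (ι r)) : Δ = Δ' :=
  h.ext hB.free h' fun r =>
    mem_of_parts hB.compl (Q := LinearMap.eqLocus (Δ ∘ₗ ι) (Δ' ∘ₗ ι)) h0 r

/-- Compatibility of the bracket with a superderivation extends from generators. -/
theorem sder_compat (hB : IsSuperBracket part gr ι dS B) {p : ZMod 2} {D : S →ₗ[ℂ] S}
    (hD : IsSDer gr (AlgHom.id ℂ S) p D)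
    (hDm : ∀ i, ∀ a ∈ gr i, D a ∈ gr (p + i))
    (hcomm : ∀ x, D (dS x) = dS (D x))
    (hgen : ∀ i j, ∀ r ∈ part i, ∀ s ∈ part j, ∀ l,
      D (pEv l (B (ι r) (ι s))) =
        pEv l (B (D (ι r)) (ι s)) + sg p i • pEv l (B (ι r) (D (ι s))))
    {i : ZMod 2} {a : S} (ha : a ∈ gr i) (b : S) (l : ℂ) :
    D (pEv l (B a b)) = pEv l (B (D a) b) + sg p i • pEv l (B a (D b)) := by
  have ext : ∀ i, ∀ a ∈ gr i, (∀ j, ∀ s ∈ part j, ∀ l, D (pEv l (B a (ι s))) =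
      pEv l (B (D a) (ι s)) + sg p i • pEv l (B a (D (ι s)))) → ∀ b l,
      D (pEv l (B a b)) = pEv l (B (D a) b) + sg p i • pEv l (B a (D b)) := by
    intro i a ha h b l
    have h1 := hB.eq_of_parts (hD.supercomm (hB.sder_pEv ha l) hDm
      (fun j b hb => hB.pEv_mem ha hb l)) (hB.sder_pEv (hDm i a ha) l) (fun j s hs => by
        simp only [LinearMap.sub_apply, LinearMap.comp_apply, LinearMap.smul_apply, h j s hs l]
        module)
    have h2 := LinearMap.congr_fun h1 b
    simp only [LinearMap.sub_apply, LinearMap.comp_apply, LinearMap.smul_apply] at h2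
    rw [← h2]
    module
  refine ext i a ha (fun j s hs l => ?_) b l
  have hιs := hB.free.ι_mem j s hs
  have h0 := ext j (ι s) hιs (fun k t ht l => hgen j k s hs t ht l) a
  have h1 : pMap D (B (ι s) a) = B (D (ι s)) a + sg p j • B (ι s) (D a) :=
    poly_ext_pEv fun l => by rw [pEv_pMap, h0, map_add, map_smul]
  have hDs : D (ι s) ∈ gr (p + j) := hDm j _ hιs
  rw [hB.skew_pEv ha hιs, map_smul, map_pSk dS l hcomm, h1, map_add, map_smul,
    hB.skew_pSk ha hDs, hB.skew_pSk (hDm i a ha) hιs]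
  simp only [sg_add_left, sg_add_right, sg_comm i p]
  rcases sg_eq_or i j with h1 | h1 <;> rcases sg_eq_or p i with h2 | h2 <;>
    rcases sg_eq_or p j with h3 | h3 <;> simp only [h1, h2, h3] <;> module

end IsSuperBracket

namespace IsSuperBracket

variable {R : Type} [AddCommGroup R] [Module ℂ R] {part : ZMod 2 → Submodule ℂ R}
  {S : Type} [Ring S] [Algebra ℂ S] {gr : ZMod 2 → Submodule ℂ S} {ι : R →ₗ[ℂ] S}
  {dS : S →ₗ[ℂ] S} {B : S →ₗ[ℂ] S →ₗ[ℂ] S[X]}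

/-- Sesquilinearity in the first argument extends from generators. -/
theorem sesq (hB : IsSuperBracket part gr ι dS B)
    (hder : ∀ a b l, dS (pEv l (B a b)) = pEv l (B (dS a) b) + pEv l (B a (dS b)))
    (hgen : ∀ i j, ∀ r ∈ part i, ∀ s ∈ part j, ∀ l,
      pEv l (B (dS (ι r)) (ι s)) = -(l • pEv l (B (ι r) (ι s)))) (a b : S) (l : ℂ) :
    pEv l (B (dS a) b) = -(l • pEv l (B a b)) := by
  have ext : ∀ i, ∀ a ∈ gr i, (∀ j, ∀ s ∈ part j, ∀ l,
      pEv l (B (dS a) (ι s)) = -(l • pEv l (B a (ι s)))) → ∀ b l,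
      pEv l (B (dS a) b) = -(l • pEv l (B a b)) := by
    intro i a ha h b l
    have h1 := hB.eq_of_parts (hB.sder_pEv (hB.der_mem i a ha) l) ((hB.sder_pEv ha l).smul (-l))
      (fun j s hs => by simp [h j s hs l])
    simpa using LinearMap.congr_fun h1 b
  have hom : ∀ i, ∀ a ∈ gr i, ∀ b l, pEv l (B (dS a) b) = -(l • pEv l (B a b)) := by
    intro i a ha
    refine ext i a ha fun j s hs l => ?_
    have hιs := hB.free.ι_mem j s hs
    have h0 := ext j (ι s) hιs (fun k t ht l => hgen j k s hs t ht l) a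
    have h1 : B (ι s) (dS a) = pMap dS (B (ι s) a) + X * B (ι s) a :=
      poly_ext_pEv fun l => by
        rw [map_add, pEv_pMap, hder, h0, pEv_X_mul]
        abel
    rw [hB.skew_pEv (hB.der_mem i a ha) hιs, h1, map_add, ← map_pSk dS l (fun _ => rfl), pSk_X_mul,
      hB.skew_pSk ha hιs, map_smul]
    rcases sg_eq_or i j with h | h <;> simp only [h] <;> module
  exact LinearMap.congr_fun (mem_of_parts hB.free.compl
    (Q := LinearMap.eqLocus (B.compr₂ (pEv l) ∘ₗ dS) (-(l • B.compr₂ (pEv l))))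
    (fun i a ha => LinearMap.ext fun b => by simpa using hom i a ha b l) a) b

theorem bracket_pSk_right (hder : ∀ a b l,
      dS (pEv l (B a b)) = pEv l (B (dS a) b) + pEv l (B a (dS b)))
    (hsesq : ∀ a b l, pEv l (B (dS a) b) = -(l • pEv l (B a b))) (a : S) (l g : ℂ) (f : S[X]) :
    pEv l (B a (pSk dS g f)) = pSk dS (g + l) (pMap (pEv l ∘ₗ B a) f) := by
  have h2 : ∀ b, pEv l (B a (dS b)) = dS (pEv l (B a b)) + l • pEv l (B a b) := fun b => by
    rw [hder, hsesq]
    abel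
  induction f using poly_induction with
  | hC a => simp
  | hadd f g hf hg => simp only [map_add, hf, hg]
  | hX f hf =>
    simp only [pSk_X_mul, pMap_X_mul, map_sub, map_neg, map_smul, h2, hf]
    module

theorem bracket_pSk_left (hsesq : ∀ a b l, pEv l (B (dS a) b) = -(l • pEv l (B a b)))
    (c : S) (l g : ℂ) (f : S[X]) :
    pEv (l + g) (B (pSk dS g f) c) = pEv (l + g) (B (pEv l f) c) := by
  induction f using poly_induction with
  | hC a => simp
  | hadd f g hf hg => simp only [map_add, LinearMap.add_apply, hf, hg]
  | hX f hf =>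
    simp only [pSk_X_mul, pEv_X_mul, map_sub, map_neg, map_smul, LinearMap.sub_apply,
      LinearMap.neg_apply, LinearMap.smul_apply, hsesq, hf]
    module

/-- The Jacobi identity for the vectors `a`, `b`, `c`, with `a`, `b` of parities `i`, `j`. -/
def Jac (B : S →ₗ[ℂ] S →ₗ[ℂ] S[X]) (i j : ZMod 2) (a b c : S) : Prop :=
  ∀ l g, pEv l (B a (pEv g (B b c))) =
    pEv (l + g) (B (pEv l (B a b)) c) + sg i j • pEv g (B b (pEv l (B a c)))

theorem jac_ext (hB : IsSuperBracket part gr ι dS B) {i j : ZMod 2} {a b : S} (ha : a ∈ gr i)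
    (hb : b ∈ gr j) (h : ∀ k, ∀ r ∈ part k, Jac B i j a b (ι r)) (c : S) : Jac B i j a b c := by
  intro l g
  have h1 := hB.eq_of_parts ((hB.sder_pEv ha l).supercomm (hB.sder_pEv hb g)
    (fun j b hb => hB.pEv_mem ha hb l) (fun j c hc => hB.pEv_mem hb hc g))
    (hB.sder_pEv (hB.pEv_mem ha hb l) (l + g)) (fun k r hr => by
      simp only [LinearMap.sub_apply, LinearMap.comp_apply, LinearMap.smul_apply, h k r hr l g]
      module)
  have h2 := LinearMap.congr_fun h1 c
  simp only [LinearMap.sub_apply, LinearMap.comp_apply, LinearMap.smul_apply] at h2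
  rw [← h2]
  module

theorem jac_swap_left (hB : IsSuperBracket part gr ι dS B)
    (hsesq : ∀ a b l, pEv l (B (dS a) b) = -(l • pEv l (B a b))) {i j : ZMod 2} {a b c : S}
    (ha : a ∈ gr i) (hb : b ∈ gr j) (h : Jac B j i b a c) : Jac B i j a b c := by
  intro l g
  rw [h g l, hB.skew_pEv hb ha, map_smul, LinearMap.smul_apply, map_smul, add_comm g l,
    bracket_pSk_left hsesq, sg_comm j i]
  rcases sg_eq_or i j with h | h <;> simp only [h] <;> module

theorem jac_swap_right (hB : IsSuperBracket part gr ι dS B)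
    (hder : ∀ a b l, dS (pEv l (B a b)) = pEv l (B (dS a) b) + pEv l (B a (dS b)))
    (hsesq : ∀ a b l, pEv l (B (dS a) b) = -(l • pEv l (B a b))) {i j k : ZMod 2} {a b c : S}
    (ha : a ∈ gr i) (hb : b ∈ gr j) (hc : c ∈ gr k) (h : Jac B i k a c b) :
    Jac B i j a b c := by
  intro l g
  have h1 : pMap (pEv l ∘ₗ B a) (B c b) =
      pTau l (B (pEv l (B a c)) b) + sg i k • B c (pEv l (B a b)) :=
    poly_ext_pEv fun g => by
      rw [pEv_pMap, LinearMap.comp_apply, h l g, map_add, map_smul, pEv_pTau]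
  rw [hB.skew_pEv hb hc, map_smul, map_smul, bracket_pSk_right hder hsesq, h1, map_add, map_smul,
    pSk_pTau, hB.skew_pSk hb (hB.pEv_mem ha hc l), hB.skew_pSk (hB.pEv_mem ha hb l) hc,
    add_comm g l]
  simp only [sg_add_left, sg_add_right, sg_comm j i]
  rcases sg_eq_or i j with h1 | h1 <;> rcases sg_eq_or i k with h2 | h2 <;>
    rcases sg_eq_or j k with h3 | h3 <;> simp only [h1, h2, h3] <;> module

/-- The Jacobi identity extends from generators. -/
theorem jac (hB : IsSuperBracket part gr ι dS B)
    (hder : ∀ a b l, dS (pEv l (B a b)) = pEv l (B (dS a) b) + pEv l (B a (dS b)))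
    (hsesq : ∀ a b l, pEv l (B (dS a) b) = -(l • pEv l (B a b)))
    (hgen : ∀ i j k, ∀ r ∈ part i, ∀ s ∈ part j, ∀ t ∈ part k, Jac B i j (ι r) (ι s) (ι t))
    {i j : ZMod 2} {a b : S} (ha : a ∈ gr i) (hb : b ∈ gr j) (c : S) : Jac B i j a b c := by
  have hι := hB.free.ι_mem
  have h1 : ∀ i j k, ∀ r ∈ part i, ∀ c ∈ gr j, ∀ s ∈ part k, Jac B i j (ι r) c (ι s) :=
    fun i j k r hr c hc s hs => hB.jac_swap_right hder hsesq (hι i r hr) hc (hι k s hs)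
      (hB.jac_ext (hι i r hr) (hι k s hs) (fun m t ht => hgen i k m r hr s hs t ht) c)
  refine hB.jac_ext ha hb (fun k r hr => hB.jac_swap_right hder hsesq ha hb (hι k r hr) ?_) c
  exact hB.jac_swap_left hsesq ha (hι k r hr)
    (hB.jac_ext (hι k r hr) ha (fun m t ht => h1 k i m r hr a ha t ht) b)

/-- The Jacobi identity in terms of coefficients. -/
theorem jac_iff_coeff (i j : ZMod 2) (a b c : S) : Jac B i j a b c ↔ ∀ m n,
    (B a ((B b c).coeff n)).coeff m = ∑ k ∈ Finset.range (m + 1),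
      ((m - k + n).choose n : ℂ) • (B ((B a b).coeff k) c).coeff (m - k + n) +
      sg i j • (B b ((B a c).coeff m)).coeff n := by
  let hs (n : ℕ) : S[X] →ₗ[ℂ] S[X] := (hasseDeriv n).restrictScalars ℂ
  let U (n : ℕ) : S →ₗ[ℂ] S[X] := hs n ∘ₗ B.flip c
  let V (n : ℕ) : S →ₗ[ℂ] S := (lcoeff S n).restrictScalars ℂ ∘ₗ B b
  have hU : ∀ n f l, pEv l (pExt (U n) f) = (pTau l (B (pEv l f) c)).coeff n := by
    intro n f l
    rw [coeff_pTau]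
    induction f using poly_induction with
    | hC a => simp [U, hs]
    | hadd f g hf hg => simp [hf, hg]
    | hX f hf => 
      have : ∀ (r : ℂ) (f : S[X]), hasseDeriv n (r • f) = r • hasseDeriv n f :=
        fun r f => (hs n).map_smul r f
      simp [hf, this]
  have hJ : Jac B i j a b c ↔ ∀ l n, pEv l (B a ((B b c).coeff n)) =
      (pTau l (B (pEv l (B a b)) c)).coeff n + sg i j • (B b (pEv l (B a c))).coeff n := by
    constructor
    · intro h l n
      have h1 : pMap (pEv l ∘ₗ B a) (B b c) =
          pTau l (B (pEv l (B a b)) c) + sg i j • B b (pEv l (B a c)) :=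
        poly_ext_pEv fun g => by
          rw [pEv_pMap, LinearMap.comp_apply, h l g, map_add, map_smul, pEv_pTau]
      simpa [coeff_pMap] using congrArg (fun f => f.coeff n) h1
    · intro h l g
      have h1 : pMap (pEv l ∘ₗ B a) (B b c) =
          pTau l (B (pEv l (B a b)) c) + sg i j • B b (pEv l (B a c)) := by
        ext n
        simpa [coeff_pMap] using h l n
      simpa [pEv_pMap, pEv_pTau] using congrArg (pEv g) h1
  have hV : ∀ n l, (B b (pEv l (B a c))).coeff n = pEv l (pMap (V n) (B a c)) := fun n l => by
    rw [pEv_pMap]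
    rfl
  have hcoeff : ∀ n m, (pExt (U n) (B a b) + sg i j • pMap (V n) (B a c)).coeff m =
      ∑ k ∈ Finset.range (m + 1),
      ((m - k + n).choose n : ℂ) • (B ((B a b).coeff k) c).coeff (m - k + n) +
      sg i j • (B b ((B a c).coeff m)).coeff n := by
    intro n m
    rw [coeff_add, coeff_smul, coeff_pExt, coeff_pMap]
    congr 1
    refine Finset.sum_congr rfl fun k _ => ?_
    simp only [U, hs, LinearMap.comp_apply, LinearMap.restrictScalars_apply, hasseDeriv_coeff,
      LinearMap.flip_apply]
    rw [Nat.cast_smul_eq_nsmul, nsmul_eq_mul]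
  have hev : ∀ l n, (pTau l (B (pEv l (B a b)) c)).coeff n +
      sg i j • (B b (pEv l (B a c))).coeff n =
      pEv l (pExt (U n) (B a b) + sg i j • pMap (V n) (B a c)) := fun l n => by
    rw [map_add, map_smul, hU, hV]
  rw [hJ]
  simp only [hev]
  constructor
  · intro h m n
    rw [poly_ext_pEv fun l => h l n, hcoeff]
  · intro h l n
    congr 1
    ext m
    rw [hcoeff, h]

end IsSuperBracket

section Modes

variable {R : Type} [AddCommGroup R] [Module ℂ R] {part : ZMod 2 → Submodule ℂ R}
  {S : Type} [Ring S] [Algebra ℂ S] {gr : ZMod 2 → Submodule ℂ S} {ι : R →ₗ[ℂ] S}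
  {dS : S →ₗ[ℂ] S} {B : S →ₗ[ℂ] S →ₗ[ℂ] S[X]}

/-- The modes `n! aₙ` of a polynomial `∑ aₙ Xⁿ`. -/
def polyModes (S : Type) [Ring S] [Algebra ℂ S] : S[X] →ₗ[ℂ] (ℕ → S) :=
  LinearMap.pi fun n => (n.factorial : ℂ) • (lcoeff S n).restrictScalars ℂ

theorem polyModes_apply (f : S[X]) (n : ℕ) : polyModes S f n = (n.factorial : ℂ) • f.coeff n := rfl

theorem coeff_eq_modes (f : S[X]) (n : ℕ) :
    f.coeff n = (n.factorial : ℂ)⁻¹ • polyModes S f n := by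
  rw [polyModes_apply, smul_smul, inv_mul_cancel₀ (Nat.cast_ne_zero.2 n.factorial_ne_zero),
    one_smul]

theorem poly_ext_modes {f g : S[X]} (h : ∀ n, polyModes S f n = polyModes S g n) : f = g := by
  ext n
  rw [coeff_eq_modes, h, ← coeff_eq_modes]

theorem polyModes_pMap (D : S →ₗ[ℂ] S) (f : S[X]) (n : ℕ) :
    polyModes S (pMap D f) n = D (polyModes S f n) := by
  simp [polyModes_apply, coeff_pMap]

theorem polyModes_X_mul_zero (f : S[X]) : polyModes S (X * f) 0 = 0 := by
  simp [polyModes_apply]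

theorem polyModes_X_mul_succ (f : S[X]) (n : ℕ) :
    polyModes S (X * f) (n + 1) = ((n + 1 : ℕ) : ℂ) • polyModes S f n := by
  simp [polyModes_apply, smul_smul, Nat.factorial_succ]

theorem polyModes_pT (der : S →ₗ[ℂ] S) (f : S[X]) (n K : ℕ)
    (hK : ∀ m, n + K ≤ m → polyModes S f m = 0) :
    polyModes S (pT der f) n = ∑ k ∈ Finset.range K,
      ((-1 : ℂ) ^ (n + k) / (k.factorial : ℂ)) • (der ^ k) (polyModes S f (n + k)) := by
  rw [polyModes_apply, coeff_pT der f n K fun m hm => by rw [coeff_eq_modes, hK m hm, smul_zero],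
    Finset.smul_sum]
  refine Finset.sum_congr rfl fun k _ => ?_
  rw [coeff_eq_modes, map_smul, smul_smul, smul_smul]
  congr 1
  rw [Nat.cast_choose ℂ (Nat.le_add_right n k), Nat.add_sub_cancel_left]
  have h1 : (n.factorial : ℂ) ≠ 0 := Nat.cast_ne_zero.2 n.factorial_ne_zero
  have h2 : (k.factorial : ℂ) ≠ 0 := Nat.cast_ne_zero.2 k.factorial_ne_zero
  have h3 : ((n + k).factorial : ℂ) ≠ 0 := Nat.cast_ne_zero.2 (n + k).factorial_ne_zero
  field_simp

theorem IsSuperBracket.jac_iff_modes (i j : ZMod 2) (a b c : S) :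
    IsSuperBracket.Jac B i j a b c ↔ ∀ m n,
      polyModes S (B a (polyModes S (B b c) n)) m = ∑ k ∈ Finset.range (m + 1),
        (m.choose k : ℂ) • polyModes S (B (polyModes S (B a b) k) c) (m + n - k) +
        sg i j • polyModes S (B b (polyModes S (B a c) m)) n := by
  rw [IsSuperBracket.jac_iff_coeff]
  refine forall_congr' fun m => forall_congr' fun n => ?_
  have hm : (m.factorial : ℂ) ≠ 0 := Nat.cast_ne_zero.2 m.factorial_ne_zero
  have hn : (n.factorial : ℂ) ≠ 0 := Nat.cast_ne_zero.2 n.factorial_ne_zero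
  rw [← (smul_right_injective S (mul_ne_zero hm hn)).eq_iff]
  have e1 : polyModes S (B a (polyModes S (B b c) n)) m =
      ((m.factorial : ℂ) * (n.factorial : ℂ)) • (B a ((B b c).coeff n)).coeff m := by
    simp only [polyModes_apply, map_smul, coeff_smul, smul_smul]
  have e2 : polyModes S (B b (polyModes S (B a c) m)) n =
      ((m.factorial : ℂ) * (n.factorial : ℂ)) • (B b ((B a c).coeff m)).coeff n := by
    simp only [polyModes_apply, map_smul, coeff_smul, smul_smul, mul_comm]
  have e3 : ∑ k ∈ Finset.range (m + 1),
      (m.choose k : ℂ) • polyModes S (B (polyModes S (B a b) k) c) (m + n - k) =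
      ((m.factorial : ℂ) * (n.factorial : ℂ)) • ∑ k ∈ Finset.range (m + 1),
        ((m - k + n).choose n : ℂ) • (B ((B a b).coeff k) c).coeff (m - k + n) := by
    rw [Finset.smul_sum]
    refine Finset.sum_congr rfl fun k hk => ?_
    have hk' : k ≤ m := Nat.lt_succ_iff.1 (Finset.mem_range.1 hk)
    have hmn : m + n - k = m - k + n := by omega
    simp only [polyModes_apply, map_smul, LinearMap.smul_apply, coeff_smul, smul_smul, hmn]
    congr 1
    rw [Nat.cast_choose ℂ hk', Nat.cast_choose ℂ (Nat.le_add_left n (m - k)),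
      Nat.add_sub_cancel]
    have h1 : (k.factorial : ℂ) ≠ 0 := Nat.cast_ne_zero.2 k.factorial_ne_zero
    have h2 : ((m - k).factorial : ℂ) ≠ 0 := Nat.cast_ne_zero.2 (m - k).factorial_ne_zero
    field_simp
  rw [e1, e2, e3, smul_add, smul_comm (sg i j)]

/-- A bilinear map with finitely supported modes is given by polynomials. -/
theorem exists_poly_of_modes (ι : R →ₗ[ℂ] S) (lb : R →ₗ[ℂ] R →ₗ[ℂ] (ℕ → R)) (bnd : R → R → ℕ)
    (h : ∀ a b n, bnd a b ≤ n → lb a b n = 0) :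
    ∃ F : R →ₗ[ℂ] R →ₗ[ℂ] S[X], ∀ r s n, polyModes S (F r s) n = ι (lb r s n) := by
  let f (r s : R) : S[X] := ∑ k ∈ Finset.range (bnd r s),
    monomial k ((k.factorial : ℂ)⁻¹ • ι (lb r s k))
  have hf : ∀ r s n, polyModes S (f r s) n = ι (lb r s n) := by
    intro r s n
    rw [polyModes_apply, finsetSum_coeff]
    simp only [coeff_monomial, Finset.sum_ite_eq', Finset.mem_range]
    split_ifs with hn
    · rw [smul_smul, mul_inv_cancel₀ (Nat.cast_ne_zero.2 n.factorial_ne_zero), one_smul]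
    · rw [h r s n (not_lt.1 hn), map_zero, smul_zero]
  refine ⟨LinearMap.mk₂ ℂ f (fun _ _ _ => poly_ext_modes fun n => ?_)
    (fun _ _ _ => poly_ext_modes fun n => ?_) (fun _ _ _ => poly_ext_modes fun n => ?_)
    (fun _ _ _ => poly_ext_modes fun n => ?_), hf⟩ <;> simp [hf]

end Modes

/-- A Lie conformal superalgebra, in terms of the modes of its bracket. -/
structure IsModeLCA {M : Type} [AddCommGroup M] [Module ℂ M] (part : ZMod 2 → Submodule ℂ M)
    (der : M →ₗ[ℂ] M) (lb : M →ₗ[ℂ] M →ₗ[ℂ] (ℕ → M)) (bnd : M → M → ℕ) : Prop where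
  compl : IsCompl (part 0) (part 1)
  der_mem : ∀ i, ∀ a ∈ part i, der a ∈ part i
  lb_mem : ∀ i j, ∀ a ∈ part i, ∀ b ∈ part j, ∀ n, lb a b n ∈ part (i + j)
  lb_bnd : ∀ a b n, bnd a b ≤ n → lb a b n = 0
  sesq_zero : ∀ a b, lb (der a) b 0 = 0
  sesq_succ : ∀ a b n, lb (der a) b (n + 1) = -((n + 1 : ℕ) : ℂ) • lb a b n
  der_lb : ∀ a b n, der (lb a b n) = lb (der a) b n + lb a (der b) n
  skew : ∀ i j, ∀ a ∈ part i, ∀ b ∈ part j, ∀ n, lb a b n =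
    -sg i j • ∑ k ∈ Finset.range (bnd b a + 1),
      (((-1 : ℂ) ^ (n + k)) / (Nat.factorial k : ℂ)) • (der ^ k) (lb b a (n + k))
  jacobi : ∀ i j, ∀ a ∈ part i, ∀ b ∈ part j, ∀ c m n, lb a (lb b c n) m =
    (∑ k ∈ Finset.range (m + 1),
      ((Nat.choose m k : ℕ) : ℂ) • lb (lb a b k) c (m + n - k)) + sg i j • lb b (lb a c m) n

/-- The Lie conformal bracket of `R` extends to the free supercommutative algebra `S`, compatibly
with odd derivations. -/
theorem IsModeLCA.exists_extension {R : Type} [AddCommGroup R] [Module ℂ R]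
    {part : ZMod 2 → Submodule ℂ R} {der : R →ₗ[ℂ] R} {lb : R →ₗ[ℂ] R →ₗ[ℂ] (ℕ → R)}
    {bnd : R → R → ℕ} (h : IsModeLCA part der lb bnd)
    {S : Type} [Ring S] [Algebra ℂ S] {gr : ZMod 2 → Submodule ℂ S} {ι : R →ₗ[ℂ] S}
    (H : IsFreeSuper part gr ι) :
    ∃ (dS : S →ₗ[ℂ] S) (lbS : S →ₗ[ℂ] S →ₗ[ℂ] (ℕ → S)),
      IsSDer gr (AlgHom.id ℂ S) 0 dS ∧ (∀ r, dS (ι r) = ι (der r)) ∧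
      (∀ r s n, lbS (ι r) (ι s) n = ι (lb r s n)) ∧
      (∀ i j, ∀ a ∈ gr i, ∀ b ∈ gr j, ∀ c n,
        lbS a (b * c) n = lbS a b n * c + sg i j • (b * lbS a c n)) ∧
      (∃ β : S → S → ℕ, ∀ a b n, β a b ≤ n → lbS a b n = 0) ∧
      (∀ β : S → S → ℕ, (∀ a b n, β a b ≤ n → lbS a b n = 0) → IsModeLCA gr dS lbS β) ∧
      ∀ (p : ZMod 2) (D : R →ₗ[ℂ] R) (D' : S →ₗ[ℂ] S), IsSDer gr (AlgHom.id ℂ S) p D' →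
        (∀ i, ∀ a ∈ gr i, D' a ∈ gr (p + i)) → (∀ r, D' (ι r) = ι (D r)) →
        (∀ x, D' (dS x) = dS (D' x)) →
        (∀ i j, ∀ a ∈ part i, ∀ b ∈ part j, ∀ n,
          D (lb a b n) = lb (D a) b n + sg p i • lb a (D b) n) →
        ∀ i, ∀ a ∈ gr i, ∀ b n, D' (lbS a b n) = lbS (D' a) b n + sg p i • lbS a (D' b) n := by
  obtain ⟨dS, hd, hdm, hdι⟩ := H.exists_sder h.compl 0 der fun i r hr => by
    rw [zero_add]
    exact h.der_mem i r hr
  replace hdm : ∀ i, ∀ a ∈ gr i, dS a ∈ gr i := fun i a ha => zero_add i ▸ hdm i a ha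
  have hdp : ∀ k r, (dS ^ k) (ι r) = ι ((der ^ k) r) := by
    intro k
    induction k with
    | zero => simp
    | succ k ih => intro r; simp [pow_succ, hdι, ih]
  obtain ⟨F, hF⟩ := exists_poly_of_modes (S := S) ι lb bnd h.lb_bnd
  obtain ⟨B, hB, hBF⟩ := H.exists_superBracket h.compl dS hd hdm F
    (fun i j r hr s hs n => by
      rw [coeff_eq_modes, hF]
      exact Submodule.smul_mem _ _ (H.ι_mem _ _ (h.lb_mem i j r hr s hs n)))
    (fun i j r hr s hs => poly_ext_modes fun n => by
      rw [map_smul, Pi.smul_apply, polyModes_pT dS _ n (bnd s r + 1) (fun m hm => by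
        rw [hF, h.lb_bnd s r m (by omega), map_zero]), hF, h.skew i j r hr s hs n]
      simp [hF, hdp])
  have hBm : ∀ r s n, polyModes S (B (ι r) (ι s)) n = ι (lb r s n) := fun r s n => by
    rw [hBF, hF]
  have compat : ∀ (p : ZMod 2) (D : R →ₗ[ℂ] R) (D' : S →ₗ[ℂ] S), IsSDer gr (AlgHom.id ℂ S) p D' →
        (∀ i, ∀ a ∈ gr i, D' a ∈ gr (p + i)) → (∀ r, D' (ι r) = ι (D r)) →
        (∀ x, D' (dS x) = dS (D' x)) →
        (∀ i j, ∀ a ∈ part i, ∀ b ∈ part j, ∀ n,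
          D (lb a b n) = lb (D a) b n + sg p i • lb a (D b) n) →
        ∀ i, ∀ a ∈ gr i, ∀ b l, D' (pEv l (B a b)) =
          pEv l (B (D' a) b) + sg p i • pEv l (B a (D' b)) := by
    intro p D D' h1 h2 h3 h4 h5 i a ha b l
    refine hB.sder_compat h1 h2 h4 (fun i j r hr s hs l => ?_) ha b l
    have : pMap D' (B (ι r) (ι s)) = B (D' (ι r)) (ι s) + sg p i • B (ι r) (D' (ι s)) :=
      poly_ext_modes fun n => by
        rw [polyModes_pMap, map_add, map_smul, Pi.add_apply, Pi.smul_apply, h3, h3, hBm, hBm, hBm,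
          h3, h5 i j r hr s hs n, map_add, map_smul]
    rw [← pEv_pMap, this, map_add, map_smul]
  have hder : ∀ a b l, dS (pEv l (B a b)) = pEv l (B (dS a) b) + pEv l (B a (dS b)) := by
    intro a b l
    refine mem_of_parts H.compl (Q := LinearMap.eqLocus (dS ∘ₗ pEv l ∘ₗ B.flip b)
      (pEv l ∘ₗ B.flip b ∘ₗ dS + pEv l ∘ₗ B.flip (dS b))) (fun i a ha => ?_) a
    have := compat 0 der dS hd (fun i a ha => by rw [zero_add]; exact hdm i a ha) hdι
      (fun _ => rfl) (fun i j a _ b _ n => by rw [sg_zero_left, one_smul, h.der_lb]) i a ha b l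
    rw [sg_zero_left, one_smul] at this
    exact this
  have hsesq : ∀ a b l, pEv l (B (dS a) b) = -(l • pEv l (B a b)) :=
    hB.sesq hder fun i j r hr s hs l => by
      have : B (dS (ι r)) (ι s) = -(X * B (ι r) (ι s)) := poly_ext_modes fun n => by
        rw [hdι, hBm, map_neg, Pi.neg_apply]
        cases n with
        | zero => rw [polyModes_X_mul_zero, h.sesq_zero, map_zero, neg_zero]
        | succ n => rw [polyModes_X_mul_succ, hBm, h.sesq_succ, map_smul, neg_smul]
      rw [this, map_neg, pEv_X_mul]
  have hX : ∀ a b, B (dS a) b = -(X * B a b) := fun a b => poly_ext_pEv fun l => by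
    rw [hsesq, map_neg, pEv_X_mul]
  have hjac : ∀ i j, ∀ a ∈ gr i, ∀ b ∈ gr j, ∀ c, IsSuperBracket.Jac B i j a b c :=
    fun _ _ _ ha _ hb => hB.jac hder hsesq (fun i j k r hr s hs t ht =>
    (IsSuperBracket.jac_iff_modes i j _ _ _).2 fun m n => by
      simp only [hBm, h.jacobi i j r hr s hs t m n, map_add, map_sum, map_smul]) ha hb
  refine ⟨dS, B.compr₂ (polyModes S), hd, hdι, hBm, fun i j a ha b hb c n => ?_,
    ⟨fun a b => (B a b).natDegree + 1, fun a b n hn => ?_⟩, fun β hβ => ?_, ?_⟩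
  · simp [LinearMap.compr₂_apply, hB.leibniz ha hb, polyModes_apply, smul_add, smul_comm (sg i j)]
  · rw [LinearMap.compr₂_apply, polyModes_apply,
      coeff_eq_zero_of_natDegree_lt (Nat.lt_of_succ_le hn), smul_zero]
  · refine ⟨H.compl, hdm, fun i j a ha b hb n => ?_, hβ, fun a b => ?_, fun a b n => ?_,
      fun a b n => ?_, fun i j a ha b hb n => ?_, fun i j a ha b hb c m n => ?_⟩ <;>
      simp only [LinearMap.compr₂_apply] at hβ ⊢
    · exact Submodule.smul_mem _ _ (hB.mem i j a ha b hb n)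
    · rw [hX, map_neg, Pi.neg_apply, polyModes_X_mul_zero, neg_zero]
    · rw [hX, map_neg, Pi.neg_apply, polyModes_X_mul_succ, neg_smul]
    · have : pMap dS (B a b) = B (dS a) b + B a (dS b) := poly_ext_pEv fun l => by
        rw [pEv_pMap, hder, map_add]
      rw [← polyModes_pMap, this, map_add, Pi.add_apply]
    · rw [hB.skew ha hb, map_smul, Pi.smul_apply, polyModes_pT dS _ n (β b a + 1)]
      exact fun m hm => hβ b a m (by omega)
    · exact (IsSuperBracket.jac_iff_modes i j a b c).1 (hjac i j a ha b hb c) m n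
  · intro p D D' h1 h2 h3 h4 h5 i a ha b n
    have : pMap D' (B a b) = B (D' a) b + sg p i • B a (D' b) := poly_ext_pEv fun l => by
      rw [pEv_pMap, compat p D D' h1 h2 h3 h4 h5 i a ha, map_add, map_smul]
    simp only [LinearMap.compr₂_apply]
    rw [← polyModes_pMap, this, map_add, map_smul, Pi.add_apply, Pi.smul_apply]

theorem sg1_mul_self (i : ZMod 2) : sg1 i * sg1 i = 1 := by
  rw [← sg_one_left, sg_mul_self]

theorem sg1_add_one (i : ZMod 2) : sg1 (i + 1) = -sg1 i := by
  rcases zmod_two_cases i with rfl | rfl <;> simp [sg1, ZMod.val_one, zmod_two_add_self]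

theorem sg_add_one_left (i j : ZMod 2) : sg (i + 1) j = sg i j * sg1 j := by
  rw [sg_add_left, sg_one_left]

theorem sg_add_one_right (i j : ZMod 2) : sg i (j + 1) = sg i j * sg1 i := by
  rw [sg_add_right, sg_comm i 1, sg_one_left]

theorem sum_range_eq_of_zero {M : Type*} [AddCommMonoid M] {f : ℕ → M} {K L : ℕ}
    (hK : ∀ k, K ≤ k → f k = 0) (hL : ∀ k, L ≤ k → f k = 0) :
    ∑ k ∈ Finset.range K, f k = ∑ k ∈ Finset.range L, f k := by
  rcases le_total K L with h | h
  · refine Finset.sum_subset (Finset.range_mono h) fun k _ hk => hK k ?_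
    simpa using hk
  · refine (Finset.sum_subset (Finset.range_mono h) fun k _ hk => hL k ?_).symm
    simpa using hk

namespace IsModeLCA

variable {M : Type} [AddCommGroup M] [Module ℂ M] {part : ZMod 2 → Submodule ℂ M}
  {der D : M →ₗ[ℂ] M} {lb : M →ₗ[ℂ] M →ₗ[ℂ] (ℕ → M)} {bnd : M → M → ℕ}

theorem bracket_der_zero (h : IsModeLCA part der lb bnd) (a b : M) :
    lb a (der b) 0 = der (lb a b 0) := by
  rw [h.der_lb, h.sesq_zero, zero_add]

theorem bracket_der_succ (h : IsModeLCA part der lb bnd) (a b : M) (n : ℕ) :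
    lb a (der b) (n + 1) = der (lb a b (n + 1)) + ((n + 1 : ℕ) : ℂ) • lb a b n := by
  rw [h.der_lb, h.sesq_succ]
  module

/-- An odd derivation of the bracket, rewritten as sesquilinearity in the second argument. -/
theorem bracket_sder (hD : ∀ i, ∀ a ∈ part i, ∀ b n,
      D (lb a b n) = lb (D a) b n + sg1 i • lb a (D b) n) (i : ZMod 2) (a : M) (ha : a ∈ part i)
    (b : M) (n : ℕ) : lb a (D b) n = sg1 (i + 1) • (lb (D a) b n - D (lb a b n)) := by
  rw [hD i a ha, sg1_add_one, sub_add_cancel_left, smul_neg, neg_smul, neg_neg, smul_smul,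
    sg1_mul_self, one_smul]

theorem bracket_sder_sder
    (hDm : ∀ i, ∀ a ∈ part i, D a ∈ part (i + 1)) (hDD : ∀ a, D (D a) = der a)
    (hD : ∀ i, ∀ a ∈ part i, ∀ b n, D (lb a b n) = lb (D a) b n + sg1 i • lb a (D b) n)
    (i : ZMod 2) (a : M) (ha : a ∈ part i) (b : M) (n : ℕ) :
    lb (D a) (D b) n = sg1 (i + 1) • (D (lb (D a) b n) - lb (der a) b n) := by
  rw [bracket_sder hD (i + 1) _ (hDm i a ha), hDD, sg1_add_one (i + 1), neg_smul, ← smul_neg,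
    neg_sub]

theorem skew_sder (h : IsModeLCA part der lb bnd)
    (hDm : ∀ i, ∀ a ∈ part i, D a ∈ part (i + 1))
    (hD : ∀ i, ∀ a ∈ part i, ∀ b n, D (lb a b n) = lb (D a) b n + sg1 i • lb a (D b) n)
    (hb0 : ∀ a b n, bnd a b ≤ n → lb (D a) b n = 0)
    (i j : ZMod 2) (a : M) (ha : a ∈ part i) (b : M) (hb : b ∈ part j) (n : ℕ) :
    lb (D a) b n = sg i j • ∑ k ∈ Finset.range (bnd b a + 1),
      (((-1 : ℂ) ^ (n + k)) / (Nat.factorial k : ℂ)) •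
        (der ^ k) (lb (D b) a (n + k) - D (lb b a (n + k))) := by
  rw [h.skew (i + 1) j _ (hDm i a ha) b hb n,
    sum_range_eq_of_zero (L := bnd b a + 1)
      (fun k hk => by rw [h.lb_bnd _ _ _ (by omega), map_zero, smul_zero])
      (fun k hk => by
        rw [bracket_sder hD j b hb, h.lb_bnd b a _ (by omega), hb0 b a _ (by omega)]
        simp)]
  simp only [bracket_sder hD j b hb, map_smul]
  simp only [smul_comm _ (sg1 (j + 1)), ← Finset.smul_sum]
  rw [smul_smul, sg_add_one_left, sg1_add_one, neg_mul_neg, mul_left_comm, sg1_mul_self, mul_one]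

theorem jacobi_sder_sder (h : IsModeLCA part der lb bnd)
    (hDm : ∀ i, ∀ a ∈ part i, D a ∈ part (i + 1)) (hDD : ∀ a, D (D a) = der a)
    (hD : ∀ i, ∀ a ∈ part i, ∀ b n, D (lb a b n) = lb (D a) b n + sg1 i • lb a (D b) n)
    (i j : ZMod 2) (a : M) (ha : a ∈ part i) (b : M) (hb : b ∈ part j) (c : M) (m n : ℕ) :
    lb (D a) (lb (D b) c n) m = sg1 (i + 1) •
      ((∑ k ∈ Finset.range (m + 1),
        ((Nat.choose m k : ℕ) : ℂ) • lb (D (lb (D a) b k)) c (m + n - k)) +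
       (∑ k ∈ Finset.range m,
        (((k + 1) * Nat.choose m (k + 1) : ℕ) : ℂ) • lb (lb a b k) c (m + n - k - 1))) +
      sg (i + 1) (j + 1) • lb (D b) (lb (D a) c m) n := by
  rw [h.jacobi (i + 1) (j + 1) _ (hDm i a ha) _ (hDm j b hb)]
  congr 1
  have h0 : ∑ k ∈ Finset.range (m + 1),
      ((Nat.choose m k : ℕ) : ℂ) • lb (lb (der a) b k) c (m + n - k) =
      -∑ k ∈ Finset.range m,
        (((k + 1) * Nat.choose m (k + 1) : ℕ) : ℂ) • lb (lb a b k) c (m + n - k - 1) := by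
    rw [Finset.sum_range_succ', h.sesq_zero, ← Finset.sum_neg_distrib]
    simp only [map_zero, LinearMap.zero_apply, Pi.zero_apply, smul_zero, add_zero]
    refine Finset.sum_congr rfl fun k _ => ?_
    rw [h.sesq_succ, map_smul, LinearMap.smul_apply, Pi.smul_apply, smul_smul, ← neg_smul,
      Nat.sub_add_eq]
    congr 1
    push_cast
    ring
  rw [← sub_neg_eq_add (∑ k ∈ Finset.range (m + 1), _), ← h0, ← Finset.sum_sub_distrib,
    Finset.smul_sum]
  refine Finset.sum_congr rfl fun k _ => ?_
  rw [bracket_sder_sder hDm hDD hD i a ha, map_smul, map_sub]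
  simp only [LinearMap.smul_apply, LinearMap.sub_apply, Pi.smul_apply, Pi.sub_apply]
  module

theorem jacobi_sder_right (h : IsModeLCA part der lb bnd)
    (hDm : ∀ i, ∀ a ∈ part i, D a ∈ part (i + 1))
    (hD : ∀ i, ∀ a ∈ part i, ∀ b n, D (lb a b n) = lb (D a) b n + sg1 i • lb a (D b) n)
    (i j : ZMod 2) (a : M) (ha : a ∈ part i) (b : M) (hb : b ∈ part j) (c : M) (m n : ℕ) :
    lb a (lb (D b) c n) m = sg1 (i + 1) •
      (∑ k ∈ Finset.range (m + 1), ((Nat.choose m k : ℕ) : ℂ) •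
        (lb (lb (D a) b k) c (m + n - k) - lb (D (lb a b k)) c (m + n - k))) +
      (sg (i + 1) (j + 1) * sg1 (j + 1)) • lb (D b) (lb a c m) n := by
  rw [h.jacobi i (j + 1) a ha _ (hDm j b hb), sg_add_one_left i (j + 1), mul_assoc, sg1_mul_self,
    mul_one, Finset.smul_sum]
  congr 1
  refine Finset.sum_congr rfl fun k _ => ?_
  rw [bracket_sder hD i a ha, map_smul, map_sub]
  simp only [LinearMap.smul_apply, LinearMap.sub_apply, Pi.smul_apply, Pi.sub_apply]
  module

/-- An `N=1` SUSY Poisson vertex algebra is a Poisson vertex algebra with an odd derivation of the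
product and of the bracket squaring to `∂`. -/
theorem isSPVA {P : Type} [Ring P] [Algebra ℂ P] {d : SPVAData P}
    (h : IsModeLCA d.part d.der d.lb1 d.bnd)
    (one_mem : (1 : P) ∈ d.part 0)
    (mul_mem : ∀ i j, ∀ a ∈ d.part i, ∀ b ∈ d.part j, a * b ∈ d.part (i + j))
    (scomm : ∀ i j, ∀ a ∈ d.part i, ∀ b ∈ d.part j, a * b = sg i j • (b * a))
    (der_mul : ∀ a b, d.der (a * b) = d.der a * b + a * d.der b)
    (leibniz : ∀ i j, ∀ a ∈ d.part i, ∀ b ∈ d.part j, ∀ c n,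
      d.lb1 a (b * c) n = d.lb1 a b n * c + sg i j • (b * d.lb1 a c n))
    (hDm : ∀ i, ∀ a ∈ d.part i, d.sder a ∈ d.part (i + 1))
    (sder_mul : ∀ i, ∀ a ∈ d.part i, ∀ b,
      d.sder (a * b) = d.sder a * b + sg1 i • (a * d.sder b))
    (hDD : ∀ a, d.sder (d.sder a) = d.der a)
    (hD : ∀ i, ∀ a ∈ d.part i, ∀ b n,
      d.sder (d.lb1 a b n) = d.lb1 (d.sder a) b n + sg1 i • d.lb1 a (d.sder b) n)
    (hlb0 : d.lb0 = d.lb1 ∘ₗ d.sder)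
    (hb0 : ∀ a b n, d.bnd a b ≤ n → d.lb1 (d.sder a) b n = 0) : d.IsSPVA := by
  have h0 : ∀ a b, d.lb0 a b = d.lb1 (d.sder a) b := fun a b => by rw [hlb0]; rfl
  refine
    { compl := h.compl
      one_mem := one_mem
      mul_mem := mul_mem
      scomm := scomm
      der_mem := h.der_mem
      der_mul := der_mul
      sder_mem := hDm
      sder_mul := sder_mul
      sder_sq := hDD
      lb0_mem := fun i j a ha b hb n => ?_
      lb1_mem := h.lb_mem
      lb0_bnd := fun a b n hn => by rw [h0, hb0 a b n hn]
      lb1_bnd := h.lb_bnd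
      sesq1₀ := fun a b => by rw [h0, hDD, h.sesq_zero]
      sesq1 := fun a b n => by rw [h0, hDD, h.sesq_succ]
      sesq1' := fun a b n => by rw [h0]
      sesq2₀ := fun i a ha b => ?_
      sesq2 := fun i a ha b n => ?_
      sesq2' := fun i a ha b n => by rw [h0, bracket_sder hD i a ha]
      skew0 := fun i j a ha b hb n => ?_
      skew1 := h.skew
      jacobi00 := fun i j a ha b hb c m n => ?_
      jacobi10 := fun i j a ha b hb c m n => ?_
      jacobi01 := fun i j a ha b hb c m n => ?_
      jacobi11 := fun i j a ha b hb c m n => ?_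
      leibniz0 := fun i j a ha b hb c n => ?_
      leibniz1 := leibniz } <;> try simp only [h0]
  · rw [add_right_comm]
    exact h.lb_mem _ _ _ (hDm i a ha) _ hb n
  · rw [bracket_sder_sder hDm hDD hD i a ha, h.sesq_zero, sub_zero]
  · rw [bracket_sder_sder hDm hDD hD i a ha, h.sesq_succ, neg_smul, sub_neg_eq_add]
  · exact h.skew_sder hDm hD hb0 i j a ha b hb n
  · exact h.jacobi_sder_sder hDm hDD hD i j a ha b hb c m n
  · exact h.jacobi_sder_right hDm hD i j a ha b hb c m n
  · rw [h.jacobi (i + 1) j _ (hDm i a ha) b hb, smul_add, smul_smul, sg_add_one_right, mul_comm]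
  · rw [h.jacobi i j a ha b hb, smul_add, smul_smul, sg_add_one_left i (j + 1), mul_assoc,
      sg1_mul_self, mul_one, sg_add_one_right, mul_comm]
  · exact leibniz (i + 1) j _ (hDm i a ha) b hb c n

end IsModeLCA

theorem SLCAData.IsSLCA.sder_lb {R : Type} [AddCommGroup R] [Module ℂ R] {d : SLCAData R}
    (h : d.IsSLCA) (i : ZMod 2) (a : R) (ha : a ∈ d.part i) (b : R) (n : ℕ) :
    d.sder (d.lb1 a b n) = d.lb1 (d.sder a) b n + sg1 i • d.lb1 a (d.sder b) n := by
  rw [h.sesq2' i a ha, h.sesq1', smul_smul, sg1_add_one, mul_neg, sg1_mul_self]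
  module

/-- The Lie conformal superalgebra underlying an `N=1` SUSY Lie conformal algebra. -/
theorem SLCAData.IsSLCA.isModeLCA {R : Type} [AddCommGroup R] [Module ℂ R] {d : SLCAData R}
    (h : d.IsSLCA) : IsModeLCA d.part d.der d.lb1 d.bnd where
  compl := h.compl
  der_mem := h.der_mem
  lb_mem := h.lb1_mem
  lb_bnd := h.lb1_bnd
  sesq_zero a b := by rw [← h.sder_sq, h.sesq1', h.sesq1₀]
  sesq_succ a b n := by rw [← h.sder_sq, h.sesq1', h.sesq1]
  der_lb a b n := by
    refine mem_of_parts h.compl (Q := LinearMap.eqLocus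
      (d.der ∘ₗ LinearMap.proj n ∘ₗ d.lb1.flip b)
      (LinearMap.proj n ∘ₗ d.lb1.flip b ∘ₗ d.der + LinearMap.proj n ∘ₗ d.lb1.flip (d.der b)))
      (fun i a ha => ?_) a
    change d.der (d.lb1 a b n) = d.lb1 (d.der a) b n + d.lb1 a (d.der b) n
    rw [← h.sder_sq, h.sder_lb i a ha, map_add, map_smul, h.sder_lb _ _ (h.sder_mem i a ha),
      h.sder_lb i a ha, h.sder_sq, h.sder_sq, sg1_add_one, smul_add, smul_smul, sg1_mul_self]
    module
  skew := h.skew1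
  jacobi i j a ha b hb c m n := by
    have h1 := h.jacobi11 i j a ha b hb c m n
    have h2 := congrArg (fun x => sg1 i • x) h1
    simp only [smul_add, smul_smul, sg1_mul_self, one_smul] at h2
    rw [h2, sg_add_one_left i (j + 1), mul_assoc (sg i (j + 1)), sg1_mul_self, mul_one,
      sg_add_one_right, mul_comm (sg i j), ← mul_assoc, sg1_mul_self, one_mul]

/-- The Lie conformal superalgebra underlying an `N=2` SUSY Lie conformal algebra. -/
theorem S2LCAData.IsS2LCA.isModeLCA {R : Type} [AddCommGroup R] [Module ℂ R] {d : S2LCAData R}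
    (h : d.IsS2LCA) : IsModeLCA d.part d.der d.lb11 d.bnd where
  compl := h.compl
  der_mem := h.der_mem
  lb_mem := h.lb11_mem
  lb_bnd := h.lb11_bnd
  sesq_zero := h.sesq1₀
  sesq_succ := h.sesq1
  der_lb a b n := by
    cases n with
    | zero => rw [h.sesq1₀, h.sesq2₀, zero_add]
    | succ n => rw [h.sesq1, h.sesq2]; module
  skew := h.skew
  jacobi := h.jacobi

namespace IsFreeSuper

variable {R : Type} [AddCommGroup R] [Module ℂ R] {part : ZMod 2 → Submodule ℂ R}
  {S : Type} [Ring S] [Algebra ℂ S] {gr : ZMod 2 → Submodule ℂ S} {ι : R →ₗ[ℂ] S}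

/-- The universal property of the free supercommutative superalgebra. -/
theorem existsUnique_lift (H : IsFreeSuper part gr ι)
    {B : Type} [Ring B] [Algebra ℂ B] {pB : ZMod 2 → Submodule ℂ B} (hB : SuperAlgTargetOK B pB)
    (f : R →ₗ[ℂ] B) (hf : ∀ i, ∀ r ∈ part i, f r ∈ pB i) :
    ∃! φ : S →ₐ[ℂ] B, (∀ r, φ (ι r) = f r) ∧ ∀ j, ∀ x ∈ gr j, φ x ∈ pB j := by
  obtain ⟨-, h1, hm, hc⟩ := hB
  obtain ⟨φ, hφ⟩ := H.lift B f fun i j a ha b hb => hc i j _ (hf i a ha) _ (hf j b hb)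
  refine ⟨φ, ⟨hφ, fun j x hx => H.homog_induct (fun j => (pB j).comap φ.toLinearMap) ?_ ?_ j x hx⟩,
    fun ψ hψ => ?_⟩
  · simpa using h1
  · intro i j r hr x _ ih
    simp only [Submodule.mem_comap, AlgHom.toLinearMap_apply, map_mul, hφ] at ih ⊢
    exact hm i j _ (hf i r hr) _ ih
  · refine AlgHom.ext fun x => H.induct (LinearMap.eqLocus ψ.toLinearMap φ.toLinearMap) ?_ ?_ x
    · simp
    · intro i r _ x ih
      simp only [LinearMap.mem_eqLocus, AlgHom.toLinearMap_apply, map_mul, hφ, hψ.1] at ih ⊢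
      rw [ih]

/-- Odd derivations of the free supercommutative superalgebra supercommute if they do so on
generators. -/
theorem sder_anticomm (H : IsFreeSuper part gr ι) {D D' Δ : S →ₗ[ℂ] S}
    (hD : IsSDer gr (AlgHom.id ℂ S) 1 D) (hD' : IsSDer gr (AlgHom.id ℂ S) 1 D')
    (hDm : ∀ j, ∀ b ∈ gr j, D b ∈ gr (1 + j)) (hDm' : ∀ j, ∀ b ∈ gr j, D' b ∈ gr (1 + j))
    (hΔ : IsSDer gr (AlgHom.id ℂ S) 0 Δ)
    (h : ∀ r, D (D' (ι r)) + D' (D (ι r)) = Δ (ι r)) (x : S) : D (D' x) + D' (D x) = Δ x := by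
  have h11 : sg 1 1 = -1 := by simp [sg_one_left, sg1, ZMod.val_one]
  have h1 := hD.supercomm hD' hDm hDm'
  have h2 : D ∘ₗ D' - (-1 : ℂ) • (D' ∘ₗ D) = D ∘ₗ D' + D' ∘ₗ D := by ext; simp
  rw [zmod_two_add_self, h11, h2] at h1
  exact LinearMap.congr_fun (h1.ext H hΔ h) x

/-- An odd operator on the generators squaring to `∂` extends to an odd derivation squaring
to `∂`. -/
theorem exists_odd_sder (H : IsFreeSuper part gr ι) (hp : IsCompl (part 0) (part 1))
    {dS : S →ₗ[ℂ] S} (hd : IsSDer gr (AlgHom.id ℂ S) 0 dS) {der D : R →ₗ[ℂ] R}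
    (hdι : ∀ r, dS (ι r) = ι (der r))
    (hDm : ∀ i, ∀ r ∈ part i, D r ∈ part (i + 1)) (hDD : ∀ r, D (D r) = der r) :
    ∃ D' : S →ₗ[ℂ] S, IsSDer gr (AlgHom.id ℂ S) 1 D' ∧ (∀ i, ∀ a ∈ gr i, D' a ∈ gr (1 + i)) ∧
      (∀ r, D' (ι r) = ι (D r)) ∧ (∀ x, D' (D' x) = dS x) := by
  obtain ⟨D', h1, h2, h3⟩ := H.exists_sder hp 1 D fun i r hr => add_comm i 1 ▸ hDm i r hr
  refine ⟨D', h1, h2, h3, fun x => ?_⟩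
  have h4 := H.sder_anticomm h1 h1 h2 h2 (hd.add hd)
    (fun r => by rw [LinearMap.add_apply, h3, h3, hDD, hdι]) x
  rw [LinearMap.add_apply, ← two_smul ℂ, ← two_smul ℂ] at h4
  exact smul_right_injective S two_ne_zero h4

end IsFreeSuper

theorem nonempty_freeSPVAExtension {R : Type} [AddCommGroup R] [Module ℂ R] (d : SLCAData R)
    (h : d.IsSLCA) : Nonempty (FreeSPVAExtension d) := by
  have H := isFreeSuper_superSym h.compl
  obtain ⟨dS, lb, hd, hdι, hlb, leibniz, ⟨β, hβ⟩, hLCA, compat⟩ := h.isModeLCA.exists_extension H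
  obtain ⟨D, hD, hDm, hDι, hDD⟩ := H.exists_odd_sder h.compl hd hdι h.sder_mem h.sder_sq
  have hDm' : ∀ i, ∀ a ∈ superSymGr d.part i, D a ∈ superSymGr d.part (i + 1) := fun i a ha =>
    add_comm 1 i ▸ hDm i a ha
  have hDlb := compat 1 d.sder D hD hDm hDι (fun x => by rw [← hDD, ← hDD])
    fun i j a ha b _ n => by rw [h.sder_lb i a ha, sg_one_left]
  simp only [sg_one_left] at hDlb
  let dA : SPVAData (SuperSym d.part) :=
    { part := superSymGr d.part
      der := dS
      sder := D
      lb0 := lb ∘ₗ D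
      lb1 := lb
      bnd := fun a b => max (β (D a) b) (β a b) }
  have hA : dA.IsSPVA := (hLCA dA.bnd fun a b n hn => hβ a b n (le_of_max_le_right hn)).isSPVA
    H.one_mem H.mul_mem H.scomm
    (fun a b => IsSDer.even_mul H hd a b) leibniz hDm'
    (fun i a ha b => by rw [← sg_one_left]; exact hD i a ha b) hDD hDlb rfl
    fun a b n hn => hβ _ b n (le_of_max_le_left hn)
  exact ⟨{
    A := SuperSym d.part
    dA := dA
    isSPVA := hA
    emb := superSymι d.part
    emb_inj := H.injective_ι
    emb_part := H.ι_mem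
    emb_der := fun r => (hdι r).symm
    emb_sder := fun r => (hDι r).symm
    emb_lb0 := fun r s n => by
      change lb (D _) _ n = _
      rw [hDι, hlb, h.sesq1']
    emb_lb1 := hlb
    free := fun B _ _ pB hB f hf => H.existsUnique_lift hB f hf }⟩

theorem nonempty_freeS2PVAExtension {R : Type} [AddCommGroup R] [Module ℂ R] (d : S2LCAData R)
    (h : d.IsS2LCA) : Nonempty (FreeS2PVAExtension d) := by
  have H := isFreeSuper_superSym h.compl
  obtain ⟨dS, lb, hd, hdι, hlb, leibniz, ⟨β, hβ⟩, hLCA, compat⟩ := h.isModeLCA.exists_extension H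
  obtain ⟨D, hD, hDm, hDι, hDD⟩ := H.exists_odd_sder h.compl hd hdι h.sder1_mem h.sder1_sq
  obtain ⟨T, hT, hTm, hTι, hTT⟩ := H.exists_odd_sder h.compl hd hdι h.sder2_mem h.sder2_sq
  have hDlb := compat 1 d.sder1 D hD hDm hDι (fun x => by rw [← hDD, ← hDD])
    fun i j a ha b _ n => by rw [h.sder1_lb i a ha, sg_one_left]
  have hTlb := compat 1 d.sder2 T hT hTm hTι (fun x => by rw [← hTT, ← hTT])
    fun i j a ha b _ n => by rw [h.sder2_lb i a ha, sg_one_left]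
  simp only [sg_one_left] at hDlb hTlb
  have hL := hLCA β hβ
  let dA : S2PVAData (SuperSym d.part) :=
    { part := superSymGr d.part
      der := dS
      sder1 := D
      sder2 := T
      lb00 := lb ∘ₗ T ∘ₗ D
      lb10 := lb ∘ₗ T
      lb01 := lb ∘ₗ D
      lb11 := lb
      bnd := β }
  have hA : dA.IsS2PVA :=
    { pva :=
        { compl := H.compl
          one_mem := H.one_mem
          mul_mem := H.mul_mem
          scomm := H.scomm
          der_mem := hL.der_mem
          der_mul := fun a b => IsSDer.even_mul H hd a b
          lb_mem := hL.lb_mem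
          lb_bnd := hβ
          sesq1₀ := hL.sesq_zero
          sesq1 := hL.sesq_succ
          sesq2₀ := hL.bracket_der_zero
          sesq2 := hL.bracket_der_succ
          skew := hL.skew
          jacobi := hL.jacobi
          leibniz := leibniz }
      sder1_mem := fun i a ha => add_comm 1 i ▸ hDm i a ha
      sder2_mem := fun i a ha => add_comm 1 i ▸ hTm i a ha
      sder1_mul := fun i a ha b => by rw [← sg_one_left]; exact hD i a ha b
      sder2_mul := fun i a ha b => by rw [← sg_one_left]; exact hT i a ha b
      sder1_sq := hDD
      sder2_sq := hTT
      anticomm := H.sder_anticomm hD hT hDm hTm (Δ := 0) (fun _ _ _ _ => by simp) fun r => by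
        rw [hTι, hDι, hDι, hTι, ← map_add, h.anticomm, map_zero, LinearMap.zero_apply]
      sder1_lb := hDlb
      sder2_lb := hTlb
      comp01 := fun _ _ _ => rfl
      comp10 := fun _ _ _ => rfl
      comp00 := fun _ _ _ => rfl }
  exact ⟨{
    A := SuperSym d.part
    dA := dA
    isS2PVA := hA
    emb := superSymι d.part
    emb_inj := H.injective_ι
    emb_part := H.ι_mem
    emb_der := fun r => (hdι r).symm
    emb_sder1 := fun r => (hDι r).symm
    emb_sder2 := fun r => (hTι r).symm
    emb_lb00 := fun r s n => by
      change lb (T (D _)) _ n = _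
      rw [hDι, hTι, hlb, h.comp00]
    emb_lb10 := fun r s n => by
      change lb (T _) _ n = _
      rw [hTι, hlb, h.comp10]
    emb_lb01 := fun r s n => by
      change lb (D _) _ n = _
      rw [hDι, hlb, h.comp01]
    emb_lb11 := hlb
    free := fun B _ _ pB hB f hf => H.existsUnique_lift hB f hf }⟩

/-- Let `R` be an `N=1` (resp. `N=2`) SUSY Lie conformal
algebra.  Then the supersymmetric algebra `S(R)` carries an `N=1` (resp.
`N=2`) SUSY PVA structure whose `Λ`-bracket extends the bracket of `R` by the
Leibniz rule and whose odd derivation(s) extend those of `R`. -/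
theorem stmt_10 {R₁ : Type} [AddCommGroup R₁] [Module ℂ R₁]
    (d₁ : SLCAData R₁) (h₁ : d₁.IsSLCA)
    {R₂ : Type} [AddCommGroup R₂] [Module ℂ R₂]
    (d₂ : S2LCAData R₂) (h₂ : d₂.IsS2LCA) :
    Nonempty (FreeSPVAExtension d₁) ∧ Nonempty (FreeS2PVAExtension d₂) := by
  exact ⟨nonempty_freeSPVAExtension d₁ h₁, nonempty_freeS2PVAExtension d₂ h₂⟩
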